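/- arXiv:2309.07964 — 12 statements merged into one kernel-verified Lean document; each statement's English description precedes it below -/
import Mathlib

section
/- Let G be a finite undirected unweighted simple graph, let f be a positive integer, let F be a set of at most f edges of G, and let π be a path that is a shortest path between its endpoints in G∖F. Then π can be partitioned into at most f+1 subpaths, each of which is a shortest path between its endpoints in the original graph G. -/
open SimpleGraph

/-- `supp` is the vertex list of a shortest `u`–`v` path in the graph `H`
(shortest = path of minimum length, counted in edges, among all `u`–`v` paths). -/
def IsShortestSupp {V : Type} (H : SimpleGraph V) (u v : V) (supp : List V) : Prop :=
  ∃ p : H.Walk u v, p.support = supp ∧ p.IsPath ∧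
    ∀ q : H.Walk u v, q.IsPath → p.length ≤ q.length

open scoped Classical in
noncomputable def chN {V : Type} (w : ℕ → V) (a b : ℕ) (e : Sym2 V) : ZMod 2 :=
  ∑ k ∈ Finset.Ico a b, if s(w k, w (k+1)) = e then 1 else 0

def dlt {V : Type} (φ : V → ZMod 2) (e : Sym2 V) : ZMod 2 :=
  Sym2.lift ⟨fun u v => φ u + φ v, fun _ _ => add_comm _ _⟩ e

lemma pair_chN {V : Type} [Fintype V] (w : ℕ → V) (φ : V → ZMod 2) (a b : ℕ) (h : a ≤ b) :
    ∑ e : Sym2 V, chN w a b e * dlt φ e = φ (w a) + φ (w b) := by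
  classical
  have h1 : ∑ e : Sym2 V, chN w a b e * dlt φ e
      = ∑ k ∈ Finset.Ico a b, (φ (w k) + φ (w (k+1))) := by
    simp only [chN, Finset.sum_mul]
    rw [Finset.sum_comm]
    refine Finset.sum_congr rfl fun k _ => ?_
    simp [dlt]
  rw [h1]
  induction b, h using Nat.le_induction with
  | base => simp [CharTwo.add_self_eq_zero]
  | succ n hn ih =>
    rw [Finset.sum_Ico_succ_top hn, ih (by
      simp only [chN, Finset.sum_mul]
      rw [Finset.sum_comm]
      refine Finset.sum_congr rfl fun k _ => ?_
      simp [dlt])]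
    have := CharTwo.add_self_eq_zero (φ (w n))
    linear_combination this

lemma reach_of_chain {V : Type} [Fintype V] (z : Sym2 V → ZMod 2) (s t : V)
    (hz : ∀ φ : V → ZMod 2, ∑ e : Sym2 V, z e * dlt φ e = φ s + φ t) :
    (fromEdgeSet {e | z e ≠ 0}).Reachable s t := by
  classical
  by_contra hcon
  have h := hz (fun v => if (fromEdgeSet {e | z e ≠ 0}).Reachable s v then 1 else 0)
  rw [if_neg hcon, if_pos (Reachable.refl s), Finset.sum_eq_zero] at h
  · simp at h
  · intro e _
    by_cases he : z e = 0
    · simp [he]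
    induction e using Sym2.ind with
    | _ u v =>
    simp only [dlt, Sym2.lift_mk]
    by_cases huv : u = v
    · subst huv; rw [CharTwo.add_self_eq_zero, mul_zero]
    have hadj : (fromEdgeSet {e | z e ≠ 0}).Adj u v := by
      simp [fromEdgeSet_adj, he, huv]
    have : (fromEdgeSet {e | z e ≠ 0}).Reachable s u ↔ (fromEdgeSet {e | z e ≠ 0}).Reachable s v :=
      ⟨fun h => h.trans hadj.reachable, fun h => h.trans hadj.symm.reachable⟩
    simp only [this, CharTwo.add_self_eq_zero, mul_zero]

lemma short_walk {V : Type} [Fintype V] (H : SimpleGraph V) (z : Sym2 V → ZMod 2) (s t : V)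
    (hz : ∀ φ : V → ZMod 2, ∑ e : Sym2 V, z e * dlt φ e = φ s + φ t)
    (K : Finset (Sym2 V)) (hK : ∀ e, z e ≠ 0 → e ∈ K) (hH : ∀ e, z e ≠ 0 → e ∈ H.edgeSet) :
    ∃ p : H.Walk s t, p.length ≤ K.card := by
  classical
  obtain ⟨p, hp⟩ := (reach_of_chain z s t hz).exists_isPath
  have hle : fromEdgeSet {e | z e ≠ 0} ≤ H := by
    intro u v h
    rw [fromEdgeSet_adj] at h
    exact hH _ h.1
  refine ⟨p.mapLe hle, ?_⟩
  rw [Walk.length_map, ← Walk.length_edges, ← List.toFinset_card_of_nodup hp.isTrail.edges_nodup]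
  apply Finset.card_le_card
  intro e he
  have := p.edges_subset_edgeSet (List.mem_toFinset.1 he)
  rw [edgeSet_fromEdgeSet] at this
  exact hK _ this.1

lemma sub_walk {V : Type} {H : SimpleGraph V} {s t : V} (P : H.Walk s t) (hP : P.IsPath)
    (a b : ℕ) (hab : a ≤ b) (hb : b ≤ P.length) :
    ∃ p : H.Walk (P.getVert a) (P.getVert b),
      p.support = (P.support.drop a).take (b - a + 1) ∧ p.IsPath ∧ p.length = b - a := by
  have hv : (P.drop a).getVert (b - a) = P.getVert b := by
    rw [Walk.drop_getVert]; congr 1; omega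
  refine ⟨((P.drop a).take (b-a)).copy rfl hv, ?_, ?_, ?_⟩
  · rw [Walk.support_copy, Walk.support_take,
      Walk.drop_support_eq_support_drop_min]
    rw [min_eq_left (by omega)]
  · rw [Walk.isPath_copy]
    exact (hP.drop a).take _
  · rw [Walk.length_copy, Walk.take_length, Walk.drop_length]; omega

lemma sub_short {V : Type} {H : SimpleGraph V} {s t : V} (P : H.Walk s t)
    (hPs : ∀ Q : H.Walk s t, Q.IsPath → P.length ≤ Q.length)
    (a b : ℕ) (hab : a ≤ b) (hb : b ≤ P.length) (q : H.Walk (P.getVert a) (P.getVert b)) :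
    b - a ≤ q.length := by
  classical
  have := hPs _ (((P.take a).append (q.append (P.drop b))).bypass_isPath)
  have h2 := ((P.take a).append (q.append (P.drop b))).length_bypass_le_length
  simp only [Walk.length_append, Walk.take_length, Walk.drop_length] at *
  omega

/-- one detour -/
lemma detour {V : Type} {G : SimpleGraph V} {F : Set (Sym2 V)} {s t : V}
    (P : (G.deleteEdges F).Walk s t)
    (hPs : ∀ Q : (G.deleteEdges F).Walk s t, Q.IsPath → P.length ≤ Q.length)
    (a b : ℕ) (hab : a ≤ b) (hb : b ≤ P.length) (q : G.Walk (P.getVert a) (P.getVert b))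
    (hq : q.length < b - a) :
    ∃ k < q.length, s(q.getVert k, q.getVert (k+1)) ∈ F := by
  by_contra hcon
  push Not at hcon
  have h := sub_short P hPs a b hab hb (q.toDeleteEdges F (by
    intro e he
    obtain ⟨k, hk, rfl⟩ := List.mem_iff_getElem.1 he
    rw [Walk.length_edges] at hk
    have := hcon k hk
    rwa [Walk.getElem_edges]))
  simp at h
  omega

lemma chN_ne {V : Type} {w : ℕ → V} {a b : ℕ} {e : Sym2 V} (h : chN w a b e ≠ 0) :
    ∃ k, a ≤ k ∧ k < b ∧ s(w k, w (k+1)) = e := by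
  classical
  obtain ⟨k, hk, h2⟩ := Finset.exists_ne_zero_of_sum_ne_zero h
  rw [Finset.mem_Ico] at hk
  exact ⟨k, hk.1, hk.2, by by_contra h3; simp [h3] at h2⟩

lemma coef_cancel {V : Type} (f ℓ : ℕ) (v : ℕ → V) (a : ℕ → ℕ) (hmono : Monotone a)
    (hlt : a (f+1) < ℓ) (g : Fin (f+1) → ZMod 2) (S : Finset (Fin (f+1)))
    (hS : ∀ i, i ∈ S ↔ g i ≠ 0) (m : Fin (f+1)) (hm : ∀ i ∈ S, i ≤ m) (e : Sym2 V)
    (he : ∀ k, k < ℓ → s(v k, v (k+1)) = e →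
      (∃ i ∈ S, a i ≤ k ∧ k < a (i+1)) ∧ ∀ i ∈ S, i ≠ m → a (i+1) ≠ k) :
    chN v 0 ℓ e + ∑ i, g i * chN v (a i) (a (i+1) + 1) e = 0 := by
  classical
  have h1 : ∀ i : Fin (f+1), chN v (a i) (a (i+1) + 1) e = ∑ k ∈ Finset.Ico 0 ℓ,
      if a i ≤ k ∧ k < a (i+1) + 1 then (if s(v k, v (k+1)) = e then 1 else 0) else 0 := by
    intro i
    rw [← Finset.sum_filter, chN]
    congr 1
    ext k
    have : a (i+1) ≤ a (f+1) := hmono (by omega)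
    simp only [Finset.mem_Ico, Finset.mem_filter]
    omega
  simp_rw [h1, Finset.mul_sum]
  rw [Finset.sum_comm, chN, ← Finset.sum_add_distrib]
  refine Finset.sum_eq_zero fun k hk => ?_
  rw [Finset.mem_Ico] at hk
  by_cases hke : s(v k, v (k+1)) = e
  swap
  · simp [hke]
  obtain ⟨⟨i, hi, h2, h3⟩, h4⟩ := he k hk.2 hke
  rw [Finset.sum_eq_single i]
  · rw [if_pos hke, if_pos (by omega)]
    have : g i = 1 := by
      have := (hS i).1 hi
      generalize g i = x at *
      revert x; decide
    rw [this]; decide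
  · intro j _ hji
    by_cases hj : j ∈ S
    swap
    · have : g j = 0 := by by_contra h; exact hj ((hS j).2 h)
      simp [this]
    rw [if_neg, mul_zero]
    rintro ⟨h5, h6⟩
    rcases lt_or_gt_of_ne hji with h | h
    · have h7 : a (j+1) ≤ a i := hmono (by exact_mod_cast h)
      exact h4 j hj (lt_of_lt_of_le h (hm i hi)).ne (by omega)
    · have h7 : a (i+1) ≤ a j := hmono (by exact_mod_cast h)
      omega
  · simp

lemma card_bound (f ℓ : ℕ) (a : ℕ → ℕ) (hmono : Monotone a)
    (hlt : a (f+1) < ℓ) (S : Finset (Fin (f+1))) :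
    ((Finset.range ℓ).filter fun k => ¬ ∃ i ∈ S, a i ≤ k ∧ k < a (i+1)).card
      + ∑ i ∈ S, (a (i+1) - a i) ≤ ℓ := by
  classical
  have h1 : (S.biUnion fun i => Finset.Ico (a i) (a (i+1))).card
      = ∑ i ∈ S, (a (i+1) - a i) := by
    rw [Finset.card_biUnion]
    · simp
    · intro i _ j _ hij
      rw [Function.onFun, Finset.disjoint_left]
      intro k hk hk'
      rw [Finset.mem_Ico] at hk hk'
      rcases lt_or_gt_of_ne hij with h | h
      · have h7 : a (i+1) ≤ a j := hmono (by exact_mod_cast h)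
        omega
      · have h7 : a (j+1) ≤ a i := hmono (by exact_mod_cast h)
        omega
  rw [← h1, ← Finset.card_union_of_disjoint]
  · conv_rhs => rw [← Finset.card_range ℓ]
    apply Finset.card_le_card
    intro k hk
    simp only [Finset.mem_union, Finset.mem_filter, Finset.mem_biUnion, Finset.mem_Ico] at hk
    rcases hk with hk | ⟨i, _, _, hk⟩
    · exact hk.1
    · have : a (i+1) ≤ a (f+1) := hmono (by omega)
      rw [Finset.mem_range]; omega
  · rw [Finset.disjoint_left]
    intro k hk hk'
    simp only [Finset.mem_filter, Finset.mem_biUnion, Finset.mem_Ico] at hk hk'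
    exact hk.2 hk'

lemma core {V : Type} [Fintype V] (G : SimpleGraph V)
    (f : ℕ) (F : Set (Sym2 V)) (hFcard : F.ncard ≤ f)
    (s t : V) (P : (G.deleteEdges F).Walk s t)
    (hPs : ∀ Q : (G.deleteEdges F).Walk s t, Q.IsPath → P.length ≤ Q.length)
    (a : ℕ → ℕ) (hmono : Monotone a) (hlt : a (f+1) < P.length)
    (hbad : ∀ i : Fin (f+1), ∃ q : G.Walk (P.getVert (a i)) (P.getVert (a (i+1) + 1)),
      q.length < a (i+1) + 1 - a i) : False := by
  classical
  choose D hD using hbad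
  have hDF : ∀ i : Fin (f+1), ∃ k < (D i).length,
      s((D i).getVert k, (D i).getVert (k+1)) ∈ F := by
    intro i
    have h1 : a (i+1) ≤ a (f+1) := hmono (by omega)
    have h2 : a i ≤ a (i+1) := hmono (by omega)
    exact detour P hPs _ _ (by omega) (by omega) (D i) (hD i)
  -- linear dependence
  have hdep : ∃ g : Fin (f+1) → ZMod 2,
      (∀ e ∈ F, ∑ i, g i * chN (D i).getVert 0 (D i).length e = 0) ∧ ∃ i, g i ≠ 0 := by
    have hnl : ¬ LinearIndependent (ZMod 2)
        (fun (i : Fin (f+1)) (e : F) => chN (D i).getVert 0 (D i).length (e : Sym2 V)) := by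
      intro hl
      have := hl.fintype_card_le_finrank
      rw [Module.finrank_fintype_fun_eq_card, Fintype.card_fin, ← Nat.card_eq_fintype_card,
        Nat.card_coe_set_eq] at this
      omega
    rw [Fintype.not_linearIndependent_iff] at hnl
    obtain ⟨g, hg, hi⟩ := hnl
    refine ⟨g, fun e he => ?_, hi⟩
    have := congrFun hg ⟨e, he⟩
    simpa using this
  obtain ⟨g, hg, i₀, hi₀⟩ := hdep
  set S : Finset (Fin (f+1)) := Finset.univ.filter fun i => g i ≠ 0 with hSdef
  have hS : ∀ i, i ∈ S ↔ g i ≠ 0 := by simp [hSdef]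
  have hSne : S.Nonempty := ⟨i₀, (hS _).2 hi₀⟩
  obtain ⟨m, hmS, hm⟩ : ∃ m ∈ S, ∀ i ∈ S, i ≤ m := ⟨S.max' hSne, S.max'_mem _, fun i hi => S.le_max' i hi⟩
  obtain ⟨v, hv⟩ : ∃ v, v = P.getVert := ⟨_, rfl⟩
  let z : Sym2 V → ZMod 2 := fun e => chN v 0 P.length e +
    ∑ i, g i * (chN v (a i) (a (i+1) + 1) e + chN (D i).getVert 0 (D i).length e)
  have hz : ∀ φ : V → ZMod 2, ∑ e : Sym2 V, z e * dlt φ e = φ s + φ t := by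
    intro φ
    simp only [z, add_mul, Finset.sum_add_distrib, Finset.sum_mul]
    rw [Finset.sum_comm, pair_chN _ _ _ _ (Nat.zero_le _)]
    have : ∑ i, ∑ e : Sym2 V, g i * (chN v (a i) (a (i+1) + 1) e
        + chN (D i).getVert 0 (D i).length e) * dlt φ e = 0 := by
      refine Finset.sum_eq_zero fun i _ => ?_
      simp only [mul_assoc, ← Finset.mul_sum, add_mul, Finset.sum_add_distrib]
      have h2 : a i ≤ a (i+1) := hmono (by omega)
      rw [pair_chN _ _ _ _ (by omega), pair_chN _ _ _ _ (Nat.zero_le _)]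
      simp [CharTwo.add_self_eq_zero, hv]
    rw [this]
    simp [hv]
  let K : Fin (f+1) → Finset (Sym2 V) := fun i =>
    ((Finset.range (D i).length).filter
      fun k => s((D i).getVert k, (D i).getVert (k+1)) ∉ F).image
        fun k => s((D i).getVert k, (D i).getVert (k+1))
  let A : Finset ℕ := ((Finset.range P.length).filter
    fun k => ¬ ∃ i ∈ S, a i ≤ k ∧ k < a (i+1)) ∪ (S.erase m).image fun i : Fin (f+1) => a (i+1)
  have hPe : ∀ k < P.length, s(v k, v (k+1)) ∈ (G.deleteEdges F).edgeSet := fun k hk => by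
    rw [hv]; exact P.adj_getVert_succ hk
  have hPB : ∀ i : Fin (f+1), ∀ k, k < a (i+1) + 1 → k < P.length := by
    intro i k hk
    have : a (i+1) ≤ a (f+1) := hmono (by omega)
    omega
  have hzF : ∀ e ∈ F, z e = 0 := by
    intro e he
    have hP0 : ∀ c d, d ≤ P.length → chN v c d e = 0 := by
      intro c d hd
      by_contra h
      obtain ⟨k, _, h2, h3⟩ := chN_ne h
      have := hPe k (by omega)
      rw [h3, edgeSet_deleteEdges] at this
      exact this.2 he
    simp only [z]
    rw [hP0 _ _ le_rfl, zero_add, ← hg e he]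
    refine Finset.sum_congr rfl fun i _ => ?_
    rw [hP0 _ _ (by have := hPB i _ (Nat.lt_succ_self _); omega), zero_add]
  obtain ⟨p, hp⟩ := short_walk (G.deleteEdges F) z s t hz
    ((A.image fun k => s(v k, v (k+1))) ∪ S.biUnion K) (by
      intro e hze
      by_contra hcon
      rw [Finset.mem_union, not_or] at hcon
      obtain ⟨hA, hK⟩ := hcon
      have heF : e ∉ F := fun h => hze (hzF e h)
      apply hze
      have h0 : ∀ i, g i * chN (D i).getVert 0 (D i).length e = 0 := by
        intro i
        by_contra h
        have h1 : i ∈ S := (hS i).2 (left_ne_zero_of_mul h)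
        obtain ⟨k, _, h2, h3⟩ := chN_ne (right_ne_zero_of_mul h)
        apply hK
        simp only [Finset.mem_biUnion, K, Finset.mem_image, Finset.mem_filter, Finset.mem_range]
        exact ⟨i, h1, k, ⟨h2, h3 ▸ heF⟩, h3⟩
      simp only [z, mul_add, h0, add_zero]
      apply coef_cancel f P.length v a hmono hlt g S hS m hm
      intro k hk hke
      have hkA : k ∉ A := fun h => hA (Finset.mem_image.2 ⟨k, h, hke⟩)
      simp only [A, Finset.mem_union, Finset.mem_filter, Finset.mem_range, Finset.mem_image,
        Finset.mem_erase, not_or] at hkA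
      constructor
      · by_contra h
        exact hkA.1 ⟨hk, h⟩
      · intro i hi him h
        exact hkA.2 ⟨i, ⟨him, hi⟩, h⟩) (by
      intro e hze
      have heF : e ∉ F := fun h => hze (hzF e h)
      by_contra hcon
      have hP0 : ∀ c d, d ≤ P.length → chN v c d e = 0 := by
        intro c d hd
        by_contra h
        obtain ⟨k, _, h2, h3⟩ := chN_ne h
        have := hPe k (by omega)
        rw [h3] at this
        exact hcon this
      apply hze
      simp only [z]
      rw [hP0 _ _ le_rfl, zero_add]
      refine Finset.sum_eq_zero fun i _ => ?_
      rw [hP0 _ _ (by have := hPB i _ (Nat.lt_succ_self _); omega), zero_add]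
      by_contra h
      obtain ⟨k, _, h2, h3⟩ := chN_ne (right_ne_zero_of_mul h)
      have h4 : s((D i).getVert k, (D i).getVert (k+1)) ∈ G.edgeSet := (D i).adj_getVert_succ h2
      rw [h3] at h4
      apply hcon
      rw [edgeSet_deleteEdges]
      exact ⟨h4, heF⟩)
  have hpl := hPs _ p.bypass_isPath
  have hpl2 := p.length_bypass_le_length
  have hc := card_bound f P.length a hmono hlt S
  have hKc : ∀ i ∈ S, (K i).card + 1 ≤ a (i+1) - a i := by
    intro i _
    obtain ⟨k, hk, hkF⟩ := hDF i
    have h1 : (K i).card ≤ ((Finset.range (D i).length).erase k).card := by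
      refine Finset.card_image_le.trans (Finset.card_le_card ?_)
      intro j hj
      rw [Finset.mem_filter] at hj
      rw [Finset.mem_erase]
      refine ⟨?_, hj.1⟩
      rintro rfl
      exact hj.2 hkF
    rw [Finset.card_erase_of_mem (Finset.mem_range.2 hk), Finset.card_range] at h1
    have := hD i
    have h2 : a i ≤ a (i+1) := hmono (by omega)
    omega
  have hKs := Finset.sum_le_sum hKc
  rw [Finset.sum_add_distrib, Finset.sum_const, smul_eq_mul, mul_one] at hKs
  have h1 : (S.biUnion K).card ≤ ∑ i ∈ S, (K i).card := Finset.card_biUnion_le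
  have h2 := Finset.card_union_le (A.image fun k => s(v k, v (k+1))) (S.biUnion K)
  have h3 : (A.image fun k => s(v k, v (k+1))).card ≤ A.card := Finset.card_image_le
  have h4 : A.card ≤ _ := Finset.card_union_le _ _
  have h5 : ((S.erase m).image fun i : Fin (f+1) => a (i+1)).card ≤ (S.erase m).card :=
    Finset.card_image_le
  rw [Finset.card_erase_of_mem hmS] at h5
  have h6 := hSne.card_pos
  omega

theorem stmt_0 {V : Type} [Fintype V] (G : SimpleGraph V)
    (f : ℕ) (hf : 0 < f)
    (F : Set (Sym2 V)) (hFE : F ⊆ G.edgeSet) (hFcard : F.ncard ≤ f)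
    (s t : V) (P : (G.deleteEdges F).Walk s t)
    (hPpath : P.IsPath)
    (hPshort : ∀ Q : (G.deleteEdges F).Walk s t, Q.IsPath → P.length ≤ Q.length) :
    ∃ (q : ℕ) (ix : ℕ → ℕ),
      q ≤ f + 1 ∧ ix 0 = 0 ∧ ix q = P.length ∧
      (∀ j, j < q → ix j ≤ ix (j + 1)) ∧
      (∀ j, j < q →
        IsShortestSupp G (P.support.getD (ix j) s) (P.support.getD (ix (j + 1)) s)
          ((P.support.drop (ix j)).take (ix (j + 1) - ix j + 1))) := by
  classical
  let good : ℕ → ℕ → Prop := fun a b =>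
    ∀ q : G.Walk (P.getVert a) (P.getVert b), b - a ≤ q.length
  obtain ⟨a, ha0, has⟩ : ∃ a : ℕ → ℕ, a 0 = 0 ∧
      ∀ n, a (n+1) = Nat.findGreatest (good (a n)) P.length :=
    ⟨fun n => Nat.rec 0 (fun _ x => Nat.findGreatest (good x) P.length) n, rfl, fun _ => rfl⟩
  have hgr : ∀ x, good x x := fun x q => by simp
  have hle : ∀ n, a n ≤ P.length := by
    intro n
    cases n with
    | zero => simp [ha0]
    | succ n => rw [has]; exact Nat.findGreatest_le _
  have hmono : Monotone a := monotone_nat_of_le_succ fun n => by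
    rw [has]; exact Nat.le_findGreatest (hle n) (hgr _)
  have hgood : ∀ n, good (a n) (a (n+1)) := fun n => by
    rw [has]; exact Nat.findGreatest_spec (hle n) (hgr _)
  have hend : a (f+1) = P.length := by
    by_contra hne
    have hlt : a (f+1) < P.length := lt_of_le_of_ne (hle _) hne
    refine core G f F hFcard s t P hPshort a hmono hlt fun i => ?_
    have h1 : a (i+1) ≤ a (f+1) := hmono (by omega)
    have h2 : ¬ good (a i) (a (i+1) + 1) :=
      Nat.findGreatest_is_greatest (P := good (a i)) (n := P.length)
        (by rw [← has]; omega) (by omega)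
    simp only [good] at h2
    push Not at h2
    exact h2
  refine ⟨f+1, a, le_rfl, ha0, hend, fun j _ => hmono (by omega), fun j _ => ?_⟩
  have hgd : ∀ k ≤ P.length, P.support.getD k s = P.getVert k := by
    intro k hk
    rw [Walk.getVert_eq_getD_support, List.getD_eq_getElem _ _ (by simp; omega),
      List.getD_eq_getElem _ _ (by simp; omega)]
  rw [hgd _ (hle _), hgd _ (hle _)]
  obtain ⟨p, hp1, hp2, hp3⟩ := sub_walk P hPpath (a j) (a (j+1)) (hmono (by omega)) (hle _)
  refine ⟨p.mapLe (deleteEdges_le F), ?_, ?_, ?_⟩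
  · simpa using hp1
  · simpa using hp2
  · intro q _
    have := hgood j q
    simpa [hp3] using this
end

section
/- Let G be a finite undirected unweighted simple graph, let f be a positive integer, let F be a set of at most f edges of G, let π be a path that is a shortest path between its endpoints in G∖F, and let k be an integer with 1 ≤ k ≤ f. Then π can be partitioned into at most k+1 subpaths such that for each subpath there exists a set F_j ⊆ F with |F_j| ≤ f−k for which that subpath is a shortest path between its endpoints in G∖F_j. -/
open SimpleGraph

theorem aux_dep {E : Type} [DecidableEq E] (D : Finset E) (k : ℕ) (hD : D.card ≤ k)
    (l : ℕ → List E) : ∃ S : Finset ℕ, S.Nonempty ∧ (∀ i ∈ S, i ≤ k) ∧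
      ∀ e ∈ D, ∑ i ∈ S, ((l i).count e : ZMod 2) = 0 := by
  classical
  have hnl : ¬ LinearIndependent (ZMod 2)
      (fun (i : Fin (k+1)) => (fun (e : D) => ((l i).count e.1 : ZMod 2))) := by
    intro h
    have := h.fintype_card_le_finrank
    simp at this
    omega
  rw [Fintype.not_linearIndependent_iff] at hnl
  obtain ⟨g, hg, i0, hi0⟩ := hnl
  refine ⟨(Finset.univ.filter (fun i : Fin (k+1) => g i ≠ 0)).map Fin.valEmbedding,
    ⟨i0, Finset.mem_map.2 ⟨i0, by simpa using hi0, rfl⟩⟩, ?_, ?_⟩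
  · intro i hi
    simp only [Finset.mem_map, Fin.valEmbedding_apply] at hi
    obtain ⟨j, _, rfl⟩ := hi
    omega
  · intro e he
    have := congrFun hg ⟨e, he⟩
    simp only [Finset.sum_apply, Pi.smul_apply, smul_eq_mul, Pi.zero_apply] at this
    rw [Finset.sum_map, Finset.sum_filter]
    refine Eq.trans ?_ this
    refine Finset.sum_congr rfl fun i _ => ?_
    have h2 : ∀ x : ZMod 2, x = 0 ∨ x = 1 := by decide
    rcases h2 (g i) with h | h <;> simp [h]

theorem aux_split {E : Type} [DecidableEq E] (D : Finset E) (δ : E → ZMod 2) (l : List E) :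
    (l.map δ).sum = ∑ e ∈ D, (l.count e : ZMod 2) * δ e
      + (l.map (fun e => if e ∈ D then 0 else δ e)).sum := by
  induction l with
  | nil => simp
  | cons x l ih =>
    simp only [List.map_cons, List.sum_cons, ih, List.count_cons, Nat.cast_add, add_mul,
      Finset.sum_add_distrib]
    by_cases hx : x ∈ D
    · simp [hx]; ring
    · simp [hx]; ring

theorem aux_count {E : Type} (R : Finset ℕ) (p : ℕ → E → Bool) (q : E → Bool) (l : List E)
    (h : ∀ e ∈ l, (∑ r ∈ R, if p r e then 1 else 0) ≤ if q e then 1 else 0) :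
    ∑ r ∈ R, l.countP (p r) ≤ l.countP q := by
  induction l with
  | nil => simp
  | cons x l ih =>
    simp only [List.countP_cons, Finset.sum_add_distrib]
    exact Nat.add_le_add (ih fun e he => h e (by simp [he])) (h x (by simp))

theorem aux_core {E : Type} [DecidableEq E] (D : Finset E) (k : ℕ) (hD : D.card ≤ k)
    (l : ℕ → List E) (a : ℕ → ℕ) (ha : ∀ i, i ≤ k → a i < a (i+1)) (δ : ℕ → E → ZMod 2)
    (h1 : ∀ i, i ≤ k → ∀ r, ((l i).map (δ r)).sum =
      (if a i < r then 1 else 0) + (if a (i+1) + 1 < r then 1 else 0))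
    (h2 : ∀ i, i ≤ k → ∀ e ∈ l i, e ∉ D → ∀ r r', δ r e ≠ 0 → δ r' e ≠ 0 → r = r')
    (h3 : ∀ i, i ≤ k → (l i).countP (fun e => decide (e ∉ D)) + 1 ≤ a (i+1) - a i) : False := by
  classical
  obtain ⟨S, hS, hSk, hdep⟩ := aux_dep D k hD l
  have hmono : ∀ i j, i ≤ j → j ≤ k + 1 → a i ≤ a j := by
    intro i j hij
    induction j, hij using Nat.le_induction with
    | base => simp
    | succ n hn ih => intro h; have := ha n (by omega); have := ih (by omega); omega
  set m := S.min' hS with hm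
  have hmS : m ∈ S := S.min'_mem hS
  have hmle : ∀ i ∈ S, m ≤ i := fun i hi => S.min'_le i hi
  set B := S.biUnion (fun i => Finset.Ioc (a i + 1) (a (i+1))) with hB
  have hmB : a m + 1 ∉ B := by
    simp only [hB, Finset.mem_biUnion, Finset.mem_Ioc, not_exists, not_and]
    intro i hi h
    have := hmono m i (hmle i hi) (by have := hSk i hi; omega)
    omega
  have hBc : B.card = ∑ i ∈ S, (a (i+1) - a i - 1) := by
    rw [hB, Finset.card_biUnion]
    · refine Finset.sum_congr rfl fun i _ => ?_
      simp; omega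
    · intro i hi j hj hij
      refine Finset.disjoint_left.2 ?_
      intro r hr hr'
      simp only [Finset.mem_Ioc] at hr hr'
      have := hSk i hi
      have := hSk j hj
      rcases Nat.lt_or_gt_of_ne hij with h | h
      · have := hmono (i+1) j h (by omega); omega
      · have := hmono (j+1) i h (by omega); omega
  set R := insert (a m + 1) B with hR
  have hRc : R.card = (∑ i ∈ S, (a (i+1) - a i - 1)) + 1 := by
    rw [hR, Finset.card_insert_of_notMem hmB, hBc]
  have hodd : ∀ r ∈ R, ∑ i ∈ S, ((if a i < r then (1 : ZMod 2) else 0)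
      + (if a (i+1) + 1 < r then 1 else 0)) = 1 := by
    intro r hr
    have : ∃ j ∈ S, (a j < r ∧ ¬ a (j+1) + 1 < r) ∧
        ∀ i ∈ S, i ≠ j → ((a i < r ↔ a (i+1) + 1 < r)) := by
      rw [hR, Finset.mem_insert] at hr
      rcases hr with rfl | hr
      · have := ha m (hSk m hmS)
        refine ⟨m, hmS, ⟨by omega, by omega⟩, ?_⟩
        intro i hi him
        have h1 := hmle i hi
        have h2 := hSk i hi
        have := hmono (m+1) i (by omega) (by omega)
        have := ha i h2
        omega
      · simp only [hB, Finset.mem_biUnion, Finset.mem_Ioc] at hr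
        obtain ⟨j, hj, hr1, hr2⟩ := hr
        refine ⟨j, hj, ⟨by omega, by omega⟩, ?_⟩
        intro i hi hij
        have h2 := hSk i hi
        have h2' := hSk j hj
        have := ha i h2
        rcases Nat.lt_or_gt_of_ne hij with h | h
        · have := hmono (i+1) j h (by omega); omega
        · have := hmono (j+1) i h (by omega); omega
    obtain ⟨j, hj, ⟨hj1, hj2⟩, hoth⟩ := this
    rw [Finset.sum_eq_single_of_mem j hj]
    · simp [hj1, hj2]
    · intro i hi hij
      have := hoth i hi hij
      have h11 : (1 : ZMod 2) + 1 = 0 := by decide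
      by_cases hh : a i < r
      · rw [if_pos hh, if_pos (this.1 hh), h11]
      · rw [if_neg hh, if_neg (fun h => hh (this.2 h)), add_zero]
  have hpos : ∀ r ∈ R, 1 ≤ ∑ i ∈ S, (l i).countP (fun e => decide (e ∉ D ∧ δ r e ≠ 0)) := by
    intro r hr
    by_contra hlt
    have h0 : ∑ i ∈ S, (l i).countP (fun e => decide (e ∉ D ∧ δ r e ≠ 0)) = 0 := by omega
    rw [Finset.sum_eq_zero_iff] at h0
    have hs := hodd r hr
    rw [← Finset.sum_congr rfl (fun i hi => h1 i (hSk i hi) r),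
      Finset.sum_congr rfl (fun i _ => aux_split D (δ r) (l i)), Finset.sum_add_distrib,
      Finset.sum_comm] at hs
    have hz1 : ∑ e ∈ D, ∑ i ∈ S, ((l i).count e : ZMod 2) * δ r e = 0 := by
      refine Finset.sum_eq_zero fun e he => ?_
      rw [← Finset.sum_mul, hdep e he, zero_mul]
    have hz2 : ∑ i ∈ S, ((l i).map (fun e => if e ∈ D then 0 else δ r e)).sum = 0 := by
      refine Finset.sum_eq_zero fun i hi => ?_
      refine List.sum_eq_zero ?_
      intro x hx
      rw [List.mem_map] at hx
      obtain ⟨e, he, rfl⟩ := hx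
      have := h0 i hi
      rw [List.countP_eq_zero] at this
      have := this e he
      by_cases hd : e ∈ D
      · simp [hd]
      · simpa [hd] using this
    rw [hz1, hz2] at hs
    exact absurd hs (by decide)
  have hA : R.card ≤ ∑ r ∈ R, ∑ i ∈ S, (l i).countP (fun e => decide (e ∉ D ∧ δ r e ≠ 0)) := by
    rw [Finset.card_eq_sum_ones]
    exact Finset.sum_le_sum hpos
  rw [Finset.sum_comm] at hA
  have hB' : ∑ i ∈ S, ∑ r ∈ R, (l i).countP (fun e => decide (e ∉ D ∧ δ r e ≠ 0))
      ≤ ∑ i ∈ S, (a (i+1) - a i - 1) := by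
    refine Finset.sum_le_sum fun i hi => ?_
    have := h3 i (hSk i hi)
    refine le_trans (aux_count R _ (fun e => decide (e ∉ D)) (l i) ?_) (by omega : _ ≤ _)
    intro e he
    by_cases hd : e ∈ D
    · simp [hd]
    · simp only [hd, not_false_eq_true, true_and, decide_eq_true_eq, decide_true, if_true]
      rw [← Finset.card_filter, Finset.card_le_one]
      intro r hr r' hr'
      simp only [Finset.mem_filter] at hr hr'
      exact h2 i (hSk i hi) e he hd r r' hr.2 hr'.2
  omega

theorem aux_walk {V : Type} {H : SimpleGraph V} (χ : V → ZMod 2) (δ : Sym2 V → ZMod 2)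
    (hδ : ∀ x y, δ s(x, y) = χ x + χ y) {u v : V} (w : H.Walk u v) :
    (w.edges.map δ).sum = χ u + χ v := by
  have h11 : ∀ x : ZMod 2, x + x = 0 := by decide
  induction w with
  | nil => simp [h11]
  | cons h p ih =>
    rename_i a b c
    simp only [Walk.edges_cons, List.map_cons, List.sum_cons, ih, hδ]
    linear_combination h11 (χ b)

theorem aux_low {V : Type} {K : SimpleGraph V} {s t : V} (P : K.Walk s t)
    (hP : ∀ Q : K.Walk s t, Q.IsPath → P.length ≤ Q.length) (a b : ℕ) (hab : a ≤ b)
    (hb : b ≤ P.length) (q : K.Walk (P.getVert a) (P.getVert b)) : b - a ≤ q.length := by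
  classical
  have h1 := hP (((P.take a).append q).append (P.drop b)).bypass (Walk.bypass_isPath _)
  have h2 := (((P.take a).append q).append (P.drop b)).length_bypass_le_length
  simp only [Walk.length_append, Walk.take_length, Walk.drop_length] at h2
  omega

theorem aux_supp {V : Type} {K H : SimpleGraph V} (hKH : K ≤ H) {s t : V} (P : K.Walk s t)
    (hPp : P.IsPath) (a b : ℕ) (hab : a ≤ b) (hb : b ≤ P.length)
    (hs : ∀ q : H.Walk (P.getVert a) (P.getVert b), b - a ≤ q.length) :
    IsShortestSupp H (P.support.getD a s) (P.support.getD b s)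
      ((P.support.drop a).take (b - a + 1)) := by
  have hg : ∀ j, j ≤ P.length → P.support.getD j s = P.getVert j := by
    intro j hj
    rw [List.getD_eq_getElem?_getD, ← Walk.getVert_eq_support_getElem? P hj]; rfl
  rw [hg a (by omega), hg b hb]
  refine ⟨(((P.drop a).take (b - a)).copy rfl
    (by rw [Walk.drop_getVert]; congr 1; omega)).mapLe hKH, ?_, ?_, ?_⟩
  · rw [Walk.support_mapLe_eq_support, Walk.support_copy, Walk.support_take,
      Walk.drop_support_eq_support_drop_min, min_eq_left (by omega)]
  · rw [Walk.isPath_mapLe, Walk.isPath_copy]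
    exact (hPp.drop a).take _
  · intro q _
    refine le_trans ?_ (hs q)
    rw [Walk.length_mapLe, Walk.length_copy, Walk.take_length]
    exact min_le_left _ _

theorem aux_main {V : Type} {K H : SimpleGraph V} (hKH : K ≤ H) (D : Finset (Sym2 V)) (k : ℕ)
    (hD : D.card ≤ k) (hKD : ∀ e ∈ H.edgeSet, e ∉ D → e ∈ K.edgeSet)
    {s t : V} (P : K.Walk s t) (hPp : P.IsPath)
    (hP : ∀ Q : K.Walk s t, Q.IsPath → P.length ≤ Q.length) :
    ∃ ix : ℕ → ℕ, ix 0 = 0 ∧ ix (k+1) = P.length ∧ ∀ j, j < k + 1 →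
      ix j ≤ ix (j+1) ∧ ix (j+1) ≤ P.length ∧
      ∀ q : H.Walk (P.getVert (ix j)) (P.getVert (ix (j+1))), ix (j+1) - ix j ≤ q.length := by
  classical
  set L := P.length with hL
  let Sh : ℕ → ℕ → Prop := fun a b => a ≤ b ∧
    ∀ q : H.Walk (P.getVert a) (P.getVert b), b - a ≤ q.length
  let nxt : ℕ → ℕ := fun a => Nat.findGreatest (Sh a) L
  have hrefl : ∀ a, Sh a a := fun a => ⟨le_rfl, fun q => by simp⟩
  have hnL : ∀ a, nxt a ≤ L := fun a => Nat.findGreatest_le L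
  have hnS : ∀ a, a ≤ L → Sh a (nxt a) := fun a h => Nat.findGreatest_spec (P := Sh a) h (hrefl a)
  have hn1 : ∀ a, a < L → a < nxt a := by
    intro a h
    refine Nat.le_findGreatest (P := Sh a) (Nat.succ_le_of_lt h) ⟨by omega, fun q => ?_⟩
    have hne := (P.adj_getVert_succ h).ne
    have : q.length ≠ 0 := fun h0 => hne (Walk.eq_of_length_eq_zero h0)
    omega
  have hnN : ∀ a, nxt a < L → ¬ Sh a (nxt a + 1) := fun a h =>
    Nat.findGreatest_is_greatest (P := Sh a) (Nat.lt_succ_self _) h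
  let ix : ℕ → ℕ := fun j => nxt^[j] 0
  have hix : ∀ j, ix (j+1) = nxt (ix j) := fun j => Function.iterate_succ_apply' nxt j 0
  have hixL : ∀ j, ix j ≤ L := by
    intro j
    cases j with
    | zero => exact Nat.zero_le _
    | succ j => rw [hix]; exact hnL _
  have hix0 : ix 0 = 0 := rfl
  clear_value ix
  by_cases hend : ix (k+1) = L
  · refine ⟨ix, hix0, hend, fun j _ => ?_⟩
    have := hnS (ix j) (hixL j)
    rw [← hix] at this
    exact ⟨this.1, hixL _, this.2⟩
  exfalso
  have hlt : ix (k+1) < L := lt_of_le_of_ne (hixL _) hend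
  have hle1 : ∀ j, ix j ≤ ix (j+1) := fun j => by
    rw [hix]; exact (hnS (ix j) (hixL j)).1
  have hmono : Monotone ix := monotone_nat_of_le_succ hle1
  have hlt' : ∀ j, j ≤ k + 1 → ix j < L := fun j hj => lt_of_le_of_lt (hmono hj) hlt
  have hQ : ∀ j, ∃ q : List (Sym2 V), j ≤ k →
      ∃ w : H.Walk (P.getVert (ix j)) (P.getVert (ix (j+1) + 1)),
        w.edges = q ∧ w.length ≤ ix (j+1) - ix j := by
    intro j
    by_cases hj : j ≤ k
    · have h := hnN (ix j) (by rw [← hix]; exact hlt' _ (by omega))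
      rw [← hix] at h
      have h' : ¬ ∀ q : H.Walk (P.getVert (ix j)) (P.getVert (ix (j+1) + 1)),
        ix (j+1) + 1 - ix j ≤ q.length := fun h' => h ⟨by have := hle1 j; omega, h'⟩
      push Not at h'
      obtain ⟨w, hw⟩ := h'
      exact ⟨w.edges, fun _ => ⟨w, rfl, by omega⟩⟩
    · exact ⟨[], fun h => absurd h hj⟩
  choose l hl using hQ
  let C : ℕ → V → Prop := fun r v => ∃ w : K.Walk s v, w.length < r
  let χ : ℕ → V → ZMod 2 := fun r v => if C r v then 1 else 0
  let δ : ℕ → Sym2 V → ZMod 2 := fun r =>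
    Sym2.lift ⟨fun x y => χ r x + χ r y, fun x y => add_comm _ _⟩
  have hδ : ∀ r x y, δ r s(x, y) = χ r x + χ r y := fun r x y => rfl
  have hχ : ∀ r j, j ≤ L → χ r (P.getVert j) = if j < r then 1 else 0 := by
    intro r j hj
    have : C r (P.getVert j) ↔ j < r := by
      constructor
      · rintro ⟨w, hw⟩
        have := aux_low P hP 0 j (Nat.zero_le _) hj (w.copy (P.getVert_zero).symm rfl)
        rw [Walk.length_copy] at this
        omega
      · intro h
        exact ⟨P.take j, by rw [Walk.take_length]; exact lt_of_le_of_lt (min_le_left _ _) h⟩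
    simp only [χ, this]
  have hstep : ∀ r x y, K.Adj x y → C r x → C (r+1) y := by
    rintro r x y h ⟨w, hw⟩
    exact ⟨w.concat h, by rw [Walk.length_concat]; omega⟩
  have hCm : ∀ r r' x, r ≤ r' → C r x → C r' x := by
    rintro r r' x h ⟨w, hw⟩
    exact ⟨w, by omega⟩
  have hcross : ∀ r x y, δ r s(x, y) ≠ 0 → ¬ (C r x ↔ C r y) := by
    intro r x y h hc
    apply h
    rw [hδ]
    have h11 : ∀ x : ZMod 2, x + x = 0 := by decide
    simp only [χ, hc]
    exact h11 _
  have huniq : ∀ r r' x y, K.Adj x y → r < r' → ¬ (C r x ↔ C r y) → (C r' x ↔ C r' y) := by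
    intro r r' x y h hr hc
    have h1 := hstep r x y h
    have h2 := hstep r y x h.symm
    have h3 := hCm r r' x hr.le
    have h4 := hCm r r' y hr.le
    have h5 := hCm (r+1) r' x hr
    have h6 := hCm (r+1) r' y hr
    clear_value C
    by_cases hx : C r x
    · exact ⟨fun _ => h6 (h1 hx), fun _ => h3 hx⟩
    · by_cases hy : C r y
      · exact ⟨fun _ => h4 hy, fun _ => h5 (h2 hy)⟩
      · exact absurd ⟨fun h => absurd h hx, fun h => absurd h hy⟩ hc
  clear_value δ χ
  refine aux_core D k hD l ix ?_ δ ?_ ?_ ?_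
  · intro i hi
    rw [hix]; exact hn1 _ (hlt' i (by omega))
  · intro i hi r
    obtain ⟨w, hw, -⟩ := hl i hi
    rw [← hw, aux_walk (χ r) (δ r) (hδ r) w, hχ r _ (hixL i), hχ r _ (Nat.succ_le_of_lt (hlt' (i+1) (by omega)))]
  · intro i hi e he heD r r' hr hr'
    obtain ⟨w, hw, -⟩ := hl i hi
    rw [← hw] at he
    have heK := hKD e (w.edges_subset_edgeSet he) heD
    induction e using Sym2.ind with
    | _ x y =>
      have hadj : K.Adj x y := heK
      rcases Nat.lt_trichotomy r r' with h | h | h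
      · exact absurd (huniq r r' x y hadj h (hcross r x y hr)) (hcross r' x y hr')
      · exact h
      · exact absurd (huniq r' r x y hadj h (hcross r' x y hr')) (hcross r x y hr)
  · intro i hi
    obtain ⟨w, hw, hlen⟩ := hl i hi
    rw [← hw]
    have hc : w.edges.countP (fun e => decide (e ∉ D)) ≤ w.edges.length := List.countP_le_length
    have hne : w.edges.countP (fun e => decide (e ∉ D)) ≠ w.edges.length := by
      intro heq
      rw [List.countP_eq_length] at heq
      have hall : ∀ e ∈ w.edges, e ∈ K.edgeSet := fun e he =>
        hKD e (w.edges_subset_edgeSet he) (by simpa using heq e he)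
      have := aux_low P hP (ix i) (ix (i+1) + 1) (by have := hle1 i; omega)
        (hlt' (i+1) (by omega)) (w.transfer K hall)
      rw [Walk.length_transfer] at this
      have := hle1 i
      omega
    rw [Walk.length_edges] at hc hne
    omega

/-- additive tradeoff: if `F` is a set of at most `f` edges of a finite
simple graph `G`, `P` is a shortest path in `G \ F`, and `1 ≤ k ≤ f`, then `P` can be
partitioned into at most `k + 1` subpaths (given by boundary indices into the vertex
sequence of `P`), such that each subpath is, for some `F_j ⊆ F` with `|F_j| ≤ f - k`,
a shortest path between its endpoints in `G \ F_j`. -/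
theorem stmt_1 {V : Type} [Fintype V] (G : SimpleGraph V)
    (f : ℕ) (hf : 0 < f)
    (F : Set (Sym2 V)) (hFE : F ⊆ G.edgeSet) (hFcard : F.ncard ≤ f)
    (k : ℕ) (hk1 : 1 ≤ k) (hkf : k ≤ f)
    (s t : V) (P : (G.deleteEdges F).Walk s t)
    (hPpath : P.IsPath)
    (hPshort : ∀ Q : (G.deleteEdges F).Walk s t, Q.IsPath → P.length ≤ Q.length) :
    ∃ (q : ℕ) (ix : ℕ → ℕ),
      q ≤ k + 1 ∧ ix 0 = 0 ∧ ix q = P.length ∧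
      (∀ j, j < q → ix j ≤ ix (j + 1)) ∧
      (∀ j, j < q →
        ∃ Fj : Set (Sym2 V), Fj ⊆ F ∧ Fj.ncard ≤ f - k ∧
          IsShortestSupp (G.deleteEdges Fj)
            (P.support.getD (ix j) s) (P.support.getD (ix (j + 1)) s)
            ((P.support.drop (ix j)).take (ix (j + 1) - ix j + 1))) := by
  classical
  obtain ⟨F', hF'F, hF'c⟩ : ∃ F' ⊆ F, F'.ncard = min (f - k) F.ncard :=
    Set.exists_subset_card_eq (min_le_right _ _)
  have hfin : F.Finite := Set.toFinite F
  have hDf : (F \ F').Finite := Set.toFinite _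
  have hDc : hDf.toFinset.card ≤ k := by
    rw [← Set.ncard_eq_toFinset_card _ hDf]
    have := Set.ncard_sdiff_add_ncard_of_subset hF'F hfin
    omega
  have hKH : G.deleteEdges F ≤ G.deleteEdges F' := deleteEdges_anti hF'F
  obtain ⟨ix, h0, hq, hix⟩ := aux_main hKH hDf.toFinset k hDc (by
    intro e he heD
    rw [edgeSet_deleteEdges] at he ⊢
    simp only [Set.Finite.mem_toFinset, Set.mem_sdiff] at heD he ⊢
    exact ⟨he.1, fun h => heD ⟨h, he.2⟩⟩) P hPpath hPshort
  refine ⟨k + 1, ix, le_rfl, h0, hq, fun j hj => (hix j hj).1, fun j hj => ?_⟩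
  obtain ⟨h1, h2, h3⟩ := hix j hj
  exact ⟨F', hF'F, by omega, aux_supp hKH P hPpath _ _ h1 h2 h3⟩
end

section
/- Let G be a finite undirected unweighted simple graph, let f be a positive integer, let F be a set of at most f edges of G, let π be a path that is a shortest path between its endpoints in G∖F, and let k be a positive integer with k ≤ f. Then π can be partitioned into q ≤ 8k+1 subpaths π_1, …, π_q such that for each j there exists a set F_j ⊆ F with k·|F_j| ≤ f (that is, |F_j| ≤ f/k) for which π_j is a shortest path between its endpoints in G∖F_j. -/
open SimpleGraph

lemma aux_seg {V : Type} {H : SimpleGraph V} {s t : V} (P : H.Walk s t) (hP : P.IsPath)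
    (i j : ℕ) (hij : i ≤ j) (hj : j ≤ P.length) :
    ∃ w : H.Walk (P.getVert i) (P.getVert j), w.length = j - i ∧
      w.support = (P.support.drop i).take (j - i + 1) ∧ w.IsPath := by
  have h : (P.drop i).getVert (j - i) = P.getVert j := by
    rw [Walk.drop_getVert]; congr 1; omega
  refine ⟨((P.drop i).take (j - i)).copy rfl h, ?_, ?_, ?_⟩
  · simp [Walk.take_length, Walk.drop_length]; omega
  · rw [Walk.support_copy, Walk.support_take, Walk.drop_support_eq_support_drop_min,
      min_eq_left (by omega)]
  · rw [Walk.isPath_copy]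
    exact (hP.drop i).take _

lemma aux_dist {V : Type} {H : SimpleGraph V} {s t : V} (P : H.Walk s t)
    (hPs : ∀ Q : H.Walk s t, Q.IsPath → P.length ≤ Q.length)
    (i j : ℕ) (hij : i ≤ j) (hj : j ≤ P.length)
    (Q : H.Walk (P.getVert i) (P.getVert j)) : j ≤ i + Q.length := by
  classical
  have h := hPs _ (((P.take i).append Q).append (P.drop j)).bypass_isPath
  have h2 := (((P.take i).append Q).append (P.drop j)).length_bypass_le_length
  simp only [Walk.length_append, Walk.take_length, Walk.drop_length] at h2
  have : i ⊓ P.length ≤ i := min_le_left _ _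
  omega

lemma aux_first {V : Type} (G : SimpleGraph V) (F A : Set (Sym2 V)) {a b : V}
    (Q : (G.deleteEdges A).Walk a b) :
    (∃ w : (G.deleteEdges F).Walk a b, w.length = Q.length) ∨
    ∃ e ∈ F, e ∉ A ∧ ∃ u ∈ e, ∃ w : (G.deleteEdges F).Walk a u, w.length + 1 ≤ Q.length := by
  induction Q with
  | nil => exact Or.inl ⟨Walk.nil, rfl⟩
  | @cons x y z h p ih =>
    rw [deleteEdges_adj] at h
    by_cases hF : s(x, y) ∈ F
    · exact Or.inr ⟨_, hF, h.2, x, by simp, Walk.nil, by simp⟩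
    · have hadj : (G.deleteEdges F).Adj x y := by rw [deleteEdges_adj]; exact ⟨h.1, hF⟩
      rcases ih with ⟨w, hw⟩ | ⟨e, he, heA, u, hu, w, hw⟩
      · exact Or.inl ⟨Walk.cons hadj w, by simp [hw]⟩
      · exact Or.inr ⟨e, he, heA, u, hu, Walk.cons hadj w, by simp; omega⟩

/-- the open ball of radius `r` -/
def auxB {V : Type} (H : SimpleGraph V) (c : V) (r : ℕ) : Set V :=
  {u | ∃ w : H.Walk c u, w.length + 1 ≤ r}

/-- faults touching the ball -/
def auxC {V : Type} (H : SimpleGraph V) (F : Set (Sym2 V)) (c : V) (r : ℕ) : Set (Sym2 V) :=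
  {e | e ∈ F ∧ ∃ u ∈ e, u ∈ auxB H c r}

/-- goodness of a subpath -/
def auxGood {V : Type} (G : SimpleGraph V) (f k : ℕ) (F : Set (Sym2 V)) {s t : V}
    (P : (G.deleteEdges F).Walk s t) (a b : ℕ) : Prop :=
  ∃ Fj : Set (Sym2 V), Fj ⊆ F ∧ k * Fj.ncard ≤ f ∧
    IsShortestSupp (G.deleteEdges Fj) (P.getVert a) (P.getVert b)
      ((P.support.drop a).take (b - a + 1))

lemma aux_good {V : Type} (G : SimpleGraph V) (f k : ℕ) (F : Set (Sym2 V)) {s t : V}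
    (P : (G.deleteEdges F).Walk s t) (hP : P.IsPath) (a b : ℕ) (hab : a ≤ b) (hb : b ≤ P.length)
    (C : Set (Sym2 V)) (hC : C ⊆ F) (hk : k * C.ncard ≤ f)
    (h : ∀ Q : (G.deleteEdges C).Walk (P.getVert a) (P.getVert b), b ≤ a + Q.length) :
    auxGood G f k F P a b := by
  obtain ⟨w, hw1, hw2, hw3⟩ := aux_seg P hP a b hab hb
  have hle : G.deleteEdges F ≤ G.deleteEdges C := deleteEdges_anti hC
  refine ⟨C, hC, hk, w.mapLe hle, ?_, ?_, ?_⟩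
  · simp [hw2]
  · exact hw3.mapLe hle
  · intro q _
    have := h q
    simp [hw1]; omega

lemma aux_bad_pre {V : Type} (G : SimpleGraph V) (f k : ℕ) (F : Set (Sym2 V)) {s t : V}
    (P : (G.deleteEdges F).Walk s t) (hP : P.IsPath)
    (hPs : ∀ Q : (G.deleteEdges F).Walk s t, Q.IsPath → P.length ≤ Q.length)
    (a r : ℕ) (hb : a + r + 1 ≤ P.length) (hbad : ¬ auxGood G f k F P a (a + r + 1)) :
    f < k * (auxC (G.deleteEdges F) F (P.getVert a) r).ncard := by
  by_contra hcon
  push Not at hcon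
  apply hbad
  refine aux_good G f k F P hP a _ (by omega) hb _ (fun e he => he.1) hcon ?_
  intro Q
  by_contra hlt
  rcases aux_first G F _ Q with ⟨w, hw⟩ | ⟨e, he, heA, u, hu, w, hw⟩
  · have := aux_dist P hPs a _ (by omega) hb w
    omega
  · exact heA ⟨he, u, hu, w, by omega⟩

lemma aux_bad_post {V : Type} (G : SimpleGraph V) (f k : ℕ) (F : Set (Sym2 V)) {s t : V}
    (P : (G.deleteEdges F).Walk s t) (hP : P.IsPath)
    (hPs : ∀ Q : (G.deleteEdges F).Walk s t, Q.IsPath → P.length ≤ Q.length)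
    (a r : ℕ) (hb : a + r + 1 ≤ P.length) (hbad : ¬ auxGood G f k F P a (a + r + 1)) :
    f < k * (auxC (G.deleteEdges F) F (P.getVert (a + r + 1)) r).ncard := by
  by_contra hcon
  push Not at hcon
  apply hbad
  refine aux_good G f k F P hP a _ (by omega) hb _ (fun e he => he.1) hcon ?_
  intro Q
  by_contra hlt
  rcases aux_first G F _ Q.reverse with ⟨w, hw⟩ | ⟨e, he, heA, u, hu, w, hw⟩
  · have := aux_dist P hPs a _ (by omega) hb w.reverse
    simp at hw this
    omega
  · simp at hw
    exact heA ⟨he, u, hu, w, by omega⟩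

lemma aux_share {V : Type} {H : SimpleGraph V} {s t : V} (P : H.Walk s t)
    (hPs : ∀ Q : H.Walk s t, Q.IsPath → P.length ≤ Q.length)
    (c c' r r' : ℕ) (hc : c ≤ P.length) (hc' : c' ≤ P.length) (u : V)
    (h : u ∈ auxB H (P.getVert c) r) (h' : u ∈ auxB H (P.getVert c') r') :
    c' + 2 ≤ c + r + r' := by
  obtain ⟨w, hw⟩ := h
  obtain ⟨w', hw'⟩ := h'
  rcases le_total c c' with hcc | hcc
  · have := aux_dist P hPs c c' hcc hc' (w.append w'.reverse)
    simp at this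
    omega
  · omega

/-- the centre used for the `i`-th interval -/
def auxCtr (x : ℕ → ℕ) (i : ℕ) : ℕ :=
  if x (i + 1) - x i ≤ x (i - 1 + 1) - x (i - 1) then x i else x (i + 1) + 1

/-- non-peaks -/
def auxOk (x : ℕ → ℕ) (i : ℕ) : Prop :=
  x (i + 1) - x i ≤ x (i - 1 + 1) - x (i - 1) ∨ x (i + 1) - x i < x (i + 1 + 1) - x (i + 1)

lemma aux_three (x : ℕ → ℕ) (hx : Monotone x) (i j m : ℕ) (hij : i < j) (hjm : j < m)
    (hi : auxOk x i) (hj : auxOk x j) (hm : auxOk x m)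
    (him1 : auxCtr x m + 2 ≤ auxCtr x i + (x (i + 1) - x i) + (x (m + 1) - x m))
    (him2 : auxCtr x i + 2 ≤ auxCtr x m + (x (i + 1) - x i) + (x (m + 1) - x m)) : False := by
  obtain ⟨j, rfl⟩ : ∃ j', j = j' + 1 := ⟨j - 1, by omega⟩
  obtain ⟨m, rfl⟩ : ∃ m', m = m' + 1 + 1 := ⟨m - 2, by omega⟩
  unfold auxOk at hi hj hm
  unfold auxCtr at *
  simp only [Nat.add_sub_cancel] at *
  have h1 := hx (show i ≤ i + 1 by omega)
  have h2 := hx (show i + 1 ≤ m + 1 by omega)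
  have h3 := hx (show m + 1 ≤ m + 1 + 1 by omega)
  have h4 := hx (show m + 1 + 1 ≤ m + 1 + 1 + 1 by omega)
  have h5 := hx (show i + 1 + 1 ≤ m + 1 + 1 by omega)
  rcases Nat.lt_or_ge i m with h | h
  · have h6 := hx (show i + 1 + 1 ≤ m + 1 by omega)
    have h7 := hx (show i + 1 ≤ i + 1 + 1 by omega)
    split_ifs at him1 him2 <;> omega
  · obtain rfl : m = i := by omega
    obtain rfl : j = m := by omega
    split_ifs at him1 him2 <;> omega

lemma aux_count_s2 {V : Type} [Fintype V] {H : SimpleGraph V} (F : Set (Sym2 V)) {s t : V}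
    (P : H.Walk s t)
    (hPs : ∀ Q : H.Walk s t, Q.IsPath → P.length ≤ Q.length) (x : ℕ → ℕ) (hx : Monotone x)
    (I : Finset ℕ) (hI : ∀ i ∈ I, auxOk x i) (hlen : ∀ i ∈ I, x (i + 1) + 1 ≤ P.length) :
    ∑ i ∈ I, (auxC H F (P.getVert (auxCtr x i)) (x (i + 1) - x i)).ncard ≤ 4 * F.ncard := by
  classical
  have hc : ∀ i ∈ I, auxCtr x i ≤ P.length := by
    intro i hi
    have h1 := hlen i hi
    have h2 := hx (show i ≤ i + 1 by omega)
    unfold auxCtr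
    split_ifs <;> omega
  have hu : ∀ u : V, (I.filter
      (fun i => u ∈ auxB H (P.getVert (auxCtr x i)) (x (i + 1) - x i))).card ≤ 2 := by
    intro u
    by_contra hcon
    push Not at hcon
    have key : ∀ i j m, i < j → j < m →
      i ∈ (I.filter (fun i => u ∈ auxB H (P.getVert (auxCtr x i)) (x (i + 1) - x i))) →
      j ∈ (I.filter (fun i => u ∈ auxB H (P.getVert (auxCtr x i)) (x (i + 1) - x i))) →
      m ∈ (I.filter (fun i => u ∈ auxB H (P.getVert (auxCtr x i)) (x (i + 1) - x i))) →
        False := by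
      intro i j m hij hjm hi hj hm
      rw [Finset.mem_filter] at hi hj hm
      have e1 := aux_share P hPs _ _ _ _ (hc i hi.1) (hc m hm.1) u hi.2 hm.2
      have e2 := aux_share P hPs _ _ _ _ (hc m hm.1) (hc i hi.1) u hm.2 hi.2
      exact aux_three x hx i j m hij hjm (hI i hi.1) (hI j hj.1) (hI m hm.1) (by omega) (by omega)
    obtain ⟨a, b, c, ha, hb, hc, hab, hac, hbc⟩ := Finset.two_lt_card_iff.1 hcon
    rcases lt_or_gt_of_ne hab with h1 | h1 <;> rcases lt_or_gt_of_ne hac with h2 | h2 <;>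
      rcases lt_or_gt_of_ne hbc with h3 | h3
    · exact key a b c h1 h3 ha hb hc
    · exact key a c b h2 h3 ha hc hb
    · omega
    · exact key c a b h2 h1 hc ha hb
    · exact key b a c h1 h2 hb ha hc
    · omega
    · exact key b c a h3 h2 hb hc ha
    · exact key c b a h3 h1 hc hb ha
  have hsum := Finset.sum_card_bipartiteAbove_eq_sum_card_bipartiteBelow (s := I)
    (t := F.toFinset)
    (fun i e => e ∈ auxC H F (P.getVert (auxCtr x i)) (x (i + 1) - x i))
  have hL : ∀ i ∈ I, (auxC H F (P.getVert (auxCtr x i)) (x (i + 1) - x i)).ncard =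
      (Finset.bipartiteAbove
        (fun i e => e ∈ auxC H F (P.getVert (auxCtr x i)) (x (i + 1) - x i))
        F.toFinset i).card := by
    intro i _
    rw [Set.ncard_eq_toFinset_card']
    congr 1
    ext e
    simp only [Set.mem_toFinset, Finset.mem_bipartiteAbove]
    exact ⟨fun h => ⟨h.1, h⟩, fun h => h.2⟩
  rw [Finset.sum_congr rfl hL, hsum, Set.ncard_eq_toFinset_card', mul_comm, ← smul_eq_mul]
  apply Finset.sum_le_card_nsmul
  intro e _
  induction e using Sym2.ind with
  | _ u v =>
    have hsub : Finset.bipartiteBelow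
        (fun i e => e ∈ auxC H F (P.getVert (auxCtr x i)) (x (i + 1) - x i)) I s(u, v) ⊆
        (I.filter (fun i => u ∈ auxB H (P.getVert (auxCtr x i)) (x (i + 1) - x i))) ∪
        (I.filter (fun i => v ∈ auxB H (P.getVert (auxCtr x i)) (x (i + 1) - x i))) := by
      intro i hi
      rw [Finset.mem_bipartiteBelow] at hi
      obtain ⟨hiI, -, y, hy, hyB⟩ := hi
      rw [Finset.mem_union, Finset.mem_filter, Finset.mem_filter]
      rw [Sym2.mem_iff] at hy
      rcases hy with rfl | rfl
      · exact Or.inl ⟨hiI, hyB⟩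
      · exact Or.inr ⟨hiI, hyB⟩
    have h1 := Finset.card_le_card hsub
    have h2 := Finset.card_union_le
      (I.filter (fun i => u ∈ auxB H (P.getVert (auxCtr x i)) (x (i + 1) - x i)))
      (I.filter (fun i => v ∈ auxB H (P.getVert (auxCtr x i)) (x (i + 1) - x i)))
    have h3 := hu u
    have h4 := hu v
    omega

/-- multiplicative tradeoff, unweighted upper bound: if `F` is a set of
at most `f` edges of a finite simple graph `G`, `P` is a shortest path in `G \ F`, and
`1 ≤ k ≤ f`, then `P` can be partitioned into `q ≤ 8k + 1` subpaths (given by boundary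
indices into the vertex sequence of `P`), such that each subpath is, for some `F_j ⊆ F`
with `k * |F_j| ≤ f` (i.e. `|F_j| ≤ f / k`), a shortest path between its endpoints in
`G \ F_j`. -/
theorem stmt_2 {V : Type} [Fintype V] (G : SimpleGraph V)
    (f : ℕ) (hf : 0 < f)
    (F : Set (Sym2 V)) (hFE : F ⊆ G.edgeSet) (hFcard : F.ncard ≤ f)
    (k : ℕ) (hk1 : 0 < k) (hkf : k ≤ f)
    (s t : V) (P : (G.deleteEdges F).Walk s t)
    (hPpath : P.IsPath)
    (hPshort : ∀ Q : (G.deleteEdges F).Walk s t, Q.IsPath → P.length ≤ Q.length) :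
    ∃ (q : ℕ) (ix : ℕ → ℕ),
      q ≤ 8 * k + 1 ∧ ix 0 = 0 ∧ ix q = P.length ∧
      (∀ j, j < q → ix j ≤ ix (j + 1)) ∧
      (∀ j, j < q →
        ∃ Fj : Set (Sym2 V), Fj ⊆ F ∧ k * Fj.ncard ≤ f ∧
          IsShortestSupp (G.deleteEdges Fj)
            (P.support.getD (ix j) s) (P.support.getD (ix (j + 1)) s)
            ((P.support.drop (ix j)).take (ix (j + 1) - ix j + 1))) := by
  classical
  have hgetD : ∀ i, i ≤ P.length → P.support.getD i s = P.getVert i := by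
    intro i hi
    rw [List.getD_eq_getElem?_getD, ← Walk.getVert_eq_support_getElem? P hi]
    rfl
  -- greedy step
  have step : ∀ a : ℕ, ∃ b : ℕ, a ≤ b ∧ (a ≤ P.length → b ≤ P.length ∧ auxGood G f k F P a b ∧
      (b < P.length → ¬ auxGood G f k F P a (b + 1))) := by
    intro a
    by_cases ha : a ≤ P.length
    · have h0 : auxGood G f k F P a a :=
        aux_good G f k F P hPpath a a le_rfl ha ∅ (Set.empty_subset _) (by simp) (by intro Q; omega)
      let S := (Finset.Icc a P.length).filter (fun b => auxGood G f k F P a b)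
      have hS : S.Nonempty := ⟨a, by simp [S, ha, h0]⟩
      have hm := S.max'_mem hS
      have hm2 : (a ≤ S.max' hS ∧ S.max' hS ≤ P.length) ∧ auxGood G f k F P a (S.max' hS) := by
        have hm3 := Finset.mem_filter.1 hm
        exact ⟨Finset.mem_Icc.1 hm3.1, hm3.2⟩
      refine ⟨S.max' hS, hm2.1.1, fun _ => ⟨hm2.1.2, hm2.2, fun hlt hg => ?_⟩⟩
      have hmem : S.max' hS + 1 ∈ S := by
        rw [Finset.mem_filter, Finset.mem_Icc]
        exact ⟨⟨by omega, by omega⟩, hg⟩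
      have := S.le_max' _ hmem
      omega
    · exact ⟨a, le_rfl, fun h => absurd h ha⟩
  choose nx hnx1 hnx2 using step
  let x : ℕ → ℕ := fun n => nx^[n] 0
  have hx0 : x 0 = 0 := rfl
  have hxs : ∀ n, x (n + 1) = nx (x n) := fun n => Function.iterate_succ_apply' nx n 0
  have hxm : Monotone x := monotone_nat_of_le_succ (fun n => by rw [hxs]; exact hnx1 _)
  have hxle : ∀ n, x n ≤ P.length := by
    intro n
    induction n with
    | zero => rw [hx0]; omega
    | succ n ih => rw [hxs]; exact (hnx2 _ ih).1
  have hgood : ∀ n, auxGood G f k F P (x n) (x (n + 1)) := by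
    intro n; rw [hxs]; exact (hnx2 _ (hxle n)).2.1
  have hbad : ∀ n, x (n + 1) < P.length → ¬ auxGood G f k F P (x n) (x (n + 1) + 1) := by
    intro n; rw [hxs]; exact (hnx2 _ (hxle n)).2.2
  by_cases hend : x (8 * k + 1) = P.length
  · refine ⟨8 * k + 1, x, le_rfl, hx0, hend, fun j _ => hxm (by omega), fun j _ => ?_⟩
    rw [hgetD _ (hxle _), hgetD _ (hxle _)]
    exact hgood j
  exfalso
  have hlt : ∀ n, n ≤ 8 * k + 1 → x n < P.length := by
    intro n hn
    have h1 := hxm hn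
    have h2 := hxle (8 * k + 1)
    omega
  have hbig : ∀ i, i < 8 * k →
      f < k * (auxC (G.deleteEdges F) F (P.getVert (auxCtr x i)) (x (i + 1) - x i)).ncard := by
    intro i hi
    have h1 := hxm (show i ≤ i + 1 by omega)
    have h2 := hlt (i + 1) (by omega)
    have h3 := hbad i h2
    have h4 : x i + (x (i + 1) - x i) + 1 = x (i + 1) + 1 := by omega
    rw [← h4] at h3
    unfold auxCtr
    split_ifs
    · exact aux_bad_pre G f k F P hPpath hPshort _ _ (by omega) h3
    · rw [← h4]
      exact aux_bad_post G f k F P hPpath hPshort _ _ (by omega) h3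
  let g : ℕ → ℕ := fun t => if auxOk x (2 * t) then 2 * t else 2 * t + 1
  have hg1 : ∀ t, auxOk x (g t) := by
    intro t
    by_cases h : auxOk x (2 * t)
    · simp [g, h]
    · simp only [g, h, if_false]
      unfold auxOk at h ⊢
      rw [Nat.add_sub_cancel]
      omega
  have hg2 : ∀ t, g t = 2 * t ∨ g t = 2 * t + 1 := by
    intro t
    by_cases h : auxOk x (2 * t) <;> simp [g, h]
  have hginj : Function.Injective g := by
    intro a b hab
    rcases hg2 a with h1 | h1 <;> rcases hg2 b with h2 | h2 <;> omega
  let I := (Finset.range (4 * k)).image g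
  have hIlt : ∀ i ∈ I, i < 8 * k := by
    intro i hi
    obtain ⟨t, ht, rfl⟩ := Finset.mem_image.1 hi
    rw [Finset.mem_range] at ht
    rcases hg2 t with h | h <;> omega
  have hIcard : I.card = 4 * k := by
    rw [Finset.card_image_of_injective _ hginj, Finset.card_range]
  have hcount := aux_count_s2 F P hPshort x hxm I
    (by
      intro i hi
      obtain ⟨t, ht, rfl⟩ := Finset.mem_image.1 hi
      exact hg1 t)
    (fun i hi => hlt (i + 1) (by have := hIlt i hi; omega))
  have hlow : I.card • (f + 1) ≤
      ∑ i ∈ I, k * (auxC (G.deleteEdges F) F (P.getVert (auxCtr x i)) (x (i + 1) - x i)).ncard :=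
    Finset.card_nsmul_le_sum _ _ _ (fun i hi => hbig i (hIlt i hi))
  rw [← Finset.mul_sum, hIcard, smul_eq_mul] at hlow
  have h5 := Nat.mul_le_mul_left k hcount
  have h6 : k * (4 * F.ncard) ≤ k * (4 * f) := Nat.mul_le_mul_left k (by omega)
  have h7 : 4 * k * (f + 1) ≤ k * (4 * f) := hlow.trans (h5.trans h6)
  nlinarith
end

section
/- For all positive integers k and f with f ≥ 6k, there exist a finite undirected unweighted simple graph G, a set F of at most f edges of G, and a path π that is a shortest path between its endpoints in G∖F, such that π cannot be partitioned into 2k subpaths each of which is a (⌊f/k⌋ − 2)-fault replacement path in G. -/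
open SimpleGraph

/-- `supp` is the vertex list of an `r`-fault replacement `u`–`v` path in `G`: for some set
`F'` of at most `r` edges of `G`, it is a shortest `u`–`v` path in `G \ F'`. -/
def IsReplSupp {V : Type} (G : SimpleGraph V) (r : ℕ) (u v : V) (supp : List V) : Prop :=
  ∃ F' : Set (Sym2 V), F' ⊆ G.edgeSet ∧ F'.ncard ≤ r ∧
    IsShortestSupp (G.deleteEdges F') u v supp

open Classical in
theorem aux_pig {V : Type} [Finite V] (F : Set (Sym2 V)) (S : Finset ℕ) (e : ℕ → Sym2 V)
    (he : ∀ i ∈ S, ∀ j ∈ S, e i = e j → i = j) :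
    (S.filter (fun i => e i ∈ F)).card ≤ F.ncard := by
  rw [Set.ncard_eq_toFinset_card F (Set.toFinite F)]
  apply Finset.card_le_card_of_injOn e
  · intro i hi
    simp at hi ⊢
    exact hi.2
  · intro i hi j hj h
    simp at hi hj
    exact he i hi.1 j hj.1 h

theorem aux_path {V : Type} (H : SimpleGraph V) (v : ℕ → V) (a m : ℕ)
    (h : ∀ i, a ≤ i → i < a + m → H.Adj (v i) (v (i+1))) :
    ∃ p : H.Walk (v a) (v (a+m)), p.length = m ∧
      p.support = (List.range' a (m+1)).map v := by
  induction m generalizing a with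
  | zero => exact ⟨Walk.nil, rfl, by simp⟩
  | succ m ih =>
    obtain ⟨p, hp, hs⟩ := ih (a+1) (fun i h1 h2 => h i (by omega) (by omega))
    have e : a + 1 + m = a + (m + 1) := by omega
    refine ⟨Walk.cons (h a le_rfl (by omega)) (p.copy rfl (by rw [e])), by simp [hp], ?_⟩
    simp only [Walk.support_cons, Walk.support_copy, hs]
    rw [List.range'_succ (n := m+1)]
    simp

theorem aux_path' {V : Type} (H : SimpleGraph V) (v : ℕ → V) (a b : ℕ) (hab : a ≤ b)
    (h : ∀ i, a ≤ i → i < b → H.Adj (v i) (v (i+1))) :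
    ∃ p : H.Walk (v a) (v b), p.length = b - a := by
  obtain ⟨m, rfl⟩ := Nat.exists_eq_add_of_le hab
  obtain ⟨p, hp, -⟩ := aux_path H v a m h
  exact ⟨p, by omega⟩

theorem aux_seg_s3 {V : Type} (G : SimpleGraph V) (r : ℕ) (v : ℕ → V) (a b : ℕ) (hab : a ≤ b)
    (h : IsReplSupp G r (v a) (v b) ((List.range' a (b - a + 1)).map v)) :
    ∃ F' : Set (Sym2 V), F'.ncard ≤ r ∧
      (∀ i, a ≤ i → i < b → (G.deleteEdges F').Adj (v i) (v (i+1))) ∧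
      ∀ q : (G.deleteEdges F').Walk (v a) (v b), b - a ≤ q.length := by
  classical
  obtain ⟨F', -, hF, p, hp, -, hmin⟩ := h
  refine ⟨F', hF, ?_, ?_⟩
  · intro i h1 h2
    have hc := p.isChain_adj_support
    rw [hp, List.isChain_iff_getElem] at hc
    have := hc (i - a) (by simp; omega)
    simp only [List.getElem_map, List.getElem_range'] at this
    have e1 : a + 1 * (i - a) = i := by omega
    have e2 : a + 1 * (i - a + 1) = i + 1 := by omega
    rwa [e1, e2] at this
  · intro q
    have h1 := hmin q.bypass q.bypass_isPath
    have h2 := q.length_bypass_le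
    have h3 := p.length_support
    rw [hp] at h3
    simp at h3
    omega

theorem aux_step {V : Type} [Finite V] (G : SimpleGraph V) (N r : ℕ) (hr : 6 ≤ r)
    (w : ℕ → ℕ → V)
    (hw : ∀ i c j d, i ≤ N → c < r → j ≤ N → d < r → w i c = w j d → i = j ∧ c = d)
    (hadj : ∀ i c j d, w i c ≠ w j d → i ≤ N → c < r → j ≤ N → d < r → i ≤ j + 1 → j ≤ i + 1 →
      G.Adj (w i c) (w j d))
    (F' : Set (Sym2 V)) (hF : F'.ncard ≤ r - 2) (i : ℕ) (hi : i + 1 ≤ N) :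
    ∃ p : (G.deleteEdges F').Walk (w (i+1) 0) (w i 0), p.length ≤ 2 := by
  classical
  by_contra hcon
  have key : ∀ c ∈ Finset.Ico 1 r, s(w (i+1) 0, w i c) ∈ F' ∨ s(w i c, w i 0) ∈ F' := by
    intro c hc
    rw [Finset.mem_Ico] at hc
    by_contra hno
    push Not at hno
    apply hcon
    have a1 : (G.deleteEdges F').Adj (w (i+1) 0) (w i c) := by
      rw [deleteEdges_adj]
      refine ⟨hadj _ _ _ _ ?_ (by omega) (by omega) (by omega) (by omega) (by omega) (by omega), hno.1⟩
      intro h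
      have := hw _ _ _ _ (by omega) (by omega) (by omega) (by omega) h
      omega
    have a2 : (G.deleteEdges F').Adj (w i c) (w i 0) := by
      rw [deleteEdges_adj]
      refine ⟨hadj _ _ _ _ ?_ (by omega) (by omega) (by omega) (by omega) (by omega) (by omega), hno.2⟩
      intro h
      have := hw _ _ _ _ (by omega) (by omega) (by omega) (by omega) h
      omega
    exact ⟨Walk.cons a1 (Walk.cons a2 Walk.nil), by simp⟩
  let e : ℕ → Sym2 V := fun c =>
    if s(w (i+1) 0, w i c) ∈ F' then s(w (i+1) 0, w i c) else s(w i c, w i 0)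
  have hmem : ∀ c, w i c ∈ e c := by
    intro c
    simp only [e]
    split_ifs <;> simp
  have hmem2 : ∀ c u, u ∈ e c → u = w i c ∨ u = w (i+1) 0 ∨ u = w i 0 := by
    intro c u
    simp only [e]
    split_ifs <;> simp <;> tauto
  have := aux_pig F' (Finset.Ico 1 r) e (by
    intro c hc d hd h
    rw [Finset.mem_Ico] at hc hd
    have h1 := hmem c
    rw [h] at h1
    rcases hmem2 d _ h1 with h | h | h <;>
      have := hw _ _ _ _ (by omega) (by omega) (by omega) (by omega) h <;> omega)
  rw [Finset.filter_true_of_mem] at this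
  · simp at this
    omega
  · intro c hc
    have := key c hc
    simp only [e]
    split_ifs with h
    · exact h
    · tauto

theorem aux_down {V : Type} [Finite V] (G : SimpleGraph V) (N r : ℕ) (hr : 6 ≤ r)
    (w : ℕ → ℕ → V)
    (hw : ∀ i c j d, i ≤ N → c < r → j ≤ N → d < r → w i c = w j d → i = j ∧ c = d)
    (hadj : ∀ i c j d, w i c ≠ w j d → i ≤ N → c < r → j ≤ N → d < r → i ≤ j + 1 → j ≤ i + 1 →
      G.Adj (w i c) (w j d))
    (F' : Set (Sym2 V)) (hF : F'.ncard ≤ r - 2) (i m : ℕ) (hi : i + m ≤ N) :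
    ∃ p : (G.deleteEdges F').Walk (w (i+m) 0) (w i 0), p.length ≤ 2 * m := by
  induction m with
  | zero => exact ⟨Walk.nil, by simp⟩
  | succ m ih =>
    obtain ⟨p, hp⟩ := ih (by omega)
    obtain ⟨q, hq⟩ := aux_step G N r hr w hw hadj F' hF (i+m) (by omega)
    exact ⟨q.append p, by rw [Walk.length_append]; omega⟩

theorem aux_A {V : Type} [Finite V] (G : SimpleGraph V) (N r : ℕ) (hr : 6 ≤ r)
    (w : ℕ → ℕ → V)
    (hw : ∀ i c j d, i ≤ N → c < r → j ≤ N → d < r → w i c = w j d → i = j ∧ c = d)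
    (B : ℕ) (hB : B + 10 * r ≤ N)
    (hch : ∀ i < r, G.Adj (w (B + 3 * i) 0) (w (B + 10 * r) 0))
    (a b : ℕ) (ha : a ≤ B) (hb : B + 3 * (r - 1) ≤ b)
    (h : IsReplSupp G (r - 2) (w a 0) (w b 0)
      ((List.range' a (b - a + 1)).map (fun i => w i 0))) : False := by
  classical
  obtain ⟨F', hF, hA, hmin⟩ := aux_seg_s3 G (r-2) (fun i => w i 0) a b (by omega) h
  have h1 := aux_pig F' (Finset.range r) (fun i => s(w (B + 3 * i) 0, w (B + 10 * r) 0)) (by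
    intro c hc d hd h
    rw [Finset.mem_range] at hc hd
    rw [Sym2.eq_iff] at h
    rcases h with h | h <;>
      have := hw _ _ _ _ (by omega) (by omega) (by omega) (by omega) h.1 <;> omega)
  have h2 := Finset.card_filter_add_card_filter_not (s := Finset.range r)
    (fun i => s(w (B + 3 * i) 0, w (B + 10 * r) 0) ∈ F')
  rw [Finset.card_range] at h2
  have h3 : 1 < ((Finset.range r).filter
    (fun i => ¬ s(w (B + 3 * i) 0, w (B + 10 * r) 0) ∈ F')).card := by omega
  rw [Finset.one_lt_card] at h3
  have h4 : ∃ i j, i < j ∧ j < r ∧ s(w (B + 3 * i) 0, w (B + 10 * r) 0) ∉ F' ∧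
      s(w (B + 3 * j) 0, w (B + 10 * r) 0) ∉ F' := by
    obtain ⟨i, hi, j, hj, hij⟩ := h3
    simp only [Finset.mem_filter, Finset.mem_range] at hi hj
    rcases lt_or_gt_of_ne hij with h | h
    · exact ⟨i, j, h, hj.1, hi.2, hj.2⟩
    · exact ⟨j, i, h, hi.1, hj.2, hi.2⟩
  obtain ⟨i, j, hij, hjr, hi, hj⟩ := h4
  obtain ⟨p, hp⟩ := aux_path' (G.deleteEdges F') (fun i => w i 0) a (B + 3 * i) (by omega)
    (fun l h1 h2 => hA l (by omega) (by omega))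
  obtain ⟨q, hq⟩ := aux_path' (G.deleteEdges F') (fun i => w i 0) (B + 3 * j) b (by omega)
    (fun l h1 h2 => hA l (by omega) (by omega))
  have a1 : (G.deleteEdges F').Adj (w (B + 3 * i) 0) (w (B + 10 * r) 0) := by
    rw [deleteEdges_adj]
    exact ⟨hch i (by omega), hi⟩
  have a2 : (G.deleteEdges F').Adj (w (B + 3 * j) 0) (w (B + 10 * r) 0) := by
    rw [deleteEdges_adj]
    exact ⟨hch j (by omega), hj⟩
  have := hmin (p.append (Walk.cons a1 (Walk.cons a2.symm q)))
  rw [Walk.length_append, Walk.length_cons, Walk.length_cons] at this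
  omega

theorem aux_B {V : Type} [Finite V] (G : SimpleGraph V) (N r : ℕ) (hr : 6 ≤ r)
    (w : ℕ → ℕ → V)
    (hw : ∀ i c j d, i ≤ N → c < r → j ≤ N → d < r → w i c = w j d → i = j ∧ c = d)
    (hadj : ∀ i c j d, w i c ≠ w j d → i ≤ N → c < r → j ≤ N → d < r → i ≤ j + 1 → j ≤ i + 1 →
      G.Adj (w i c) (w j d))
    (B : ℕ) (hB : B + 10 * r ≤ N)
    (hch : ∀ i < r, G.Adj (w (B + 3 * i) 0) (w (B + 10 * r) 0))
    (a b : ℕ) (ha : a ≤ B + 3 * (r - 1)) (hb : B + 10 * r ≤ b)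
    (h : IsReplSupp G (r - 2) (w a 0) (w b 0)
      ((List.range' a (b - a + 1)).map (fun i => w i 0))) : False := by
  classical
  obtain ⟨F', hF, hA, hmin⟩ := aux_seg_s3 G (r-2) (fun i => w i 0) a b (by omega) h
  have h1 := aux_pig F' (Finset.range r) (fun i => s(w (B + 3 * i) 0, w (B + 10 * r) 0)) (by
    intro c hc d hd h
    rw [Finset.mem_range] at hc hd
    rw [Sym2.eq_iff] at h
    rcases h with h | h <;>
      have := hw _ _ _ _ (by omega) (by omega) (by omega) (by omega) h.1 <;> omega)
  have h4 : ∃ i, i < r ∧ s(w (B + 3 * i) 0, w (B + 10 * r) 0) ∉ F' := by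
    by_contra hno
    push Not at hno
    rw [Finset.filter_true_of_mem (fun i hi => hno i (Finset.mem_range.1 hi))] at h1
    simp at h1
    omega
  obtain ⟨i, hir, hi⟩ := h4
  obtain ⟨q, hq⟩ := aux_path' (G.deleteEdges F') (fun i => w i 0) (B + 10 * r) b (by omega)
    (fun l h1 h2 => hA l (by omega) (by omega))
  have a1 : (G.deleteEdges F').Adj (w (B + 3 * i) 0) (w (B + 10 * r) 0) := by
    rw [deleteEdges_adj]
    exact ⟨hch i (by omega), hi⟩
  rcases le_total a (B + 3 * i) with hle | hle
  · obtain ⟨p, hp⟩ := aux_path' (G.deleteEdges F') (fun i => w i 0) a (B + 3 * i) (by omega)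
      (fun l h1 h2 => hA l (by omega) (by omega))
    have := hmin (p.append (Walk.cons a1 q))
    rw [Walk.length_append, Walk.length_cons] at this
    omega
  · obtain ⟨m, rfl⟩ := Nat.exists_eq_add_of_le hle
    obtain ⟨p, hp⟩ := aux_down G N r hr w hw hadj F' hF (B + 3 * i) m (by omega)
    have := hmin (p.append (Walk.cons a1 q))
    rw [Walk.length_append, Walk.length_cons] at this
    omega

theorem aux_pot {V : Type} (H : SimpleGraph V) (φ : V → ℕ)
    (h : ∀ u v, H.Adj u v → φ v ≤ φ u + 1) {u v : V} (p : H.Walk u v) :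
    φ v ≤ φ u + p.length := by
  induction p with
  | nil => simp
  | cons h' p ih =>
    have := h _ _ h'
    rw [Walk.length_cons]
    omega

theorem aux_main_s3 {V : Type} [Finite V] (k r N : ℕ) (hk : 0 < k) (hr : 6 ≤ r)
    (hN : N = k * (10 * r)) (φ : V → ℕ) (w : ℕ → ℕ → V)
    (hφ : ∀ i c, i ≤ N → c < r → φ (w i c) = i)
    (hw : ∀ i c j d, i ≤ N → c < r → j ≤ N → d < r → w i c = w j d → i = j ∧ c = d) :
    ∃ (G : SimpleGraph V) (F : Set (Sym2 V)) (s t : V)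
      (P : (G.deleteEdges F).Walk s t),
      F ⊆ G.edgeSet ∧ F.ncard ≤ k * r ∧ P.IsPath ∧
      (∀ Q : (G.deleteEdges F).Walk s t, Q.IsPath → P.length ≤ Q.length) ∧
      ¬ ∃ ix : ℕ → ℕ,
          ix 0 = 0 ∧ ix (2 * k) = P.length ∧
          (∀ j, j < 2 * k → ix j ≤ ix (j + 1)) ∧
          (∀ j, j < 2 * k →
            IsReplSupp G (r - 2)
              (P.support.getD (ix j) s) (P.support.getD (ix (j + 1)) s)
              ((P.support.drop (ix j)).take (ix (j + 1) - ix j + 1))) := by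
  classical
  let F : Finset (Sym2 V) := (Finset.range k ×ˢ Finset.range r).image
    (fun x => s(w (x.1 * (10 * r) + 3 * x.2) 0, w (x.1 * (10 * r) + 10 * r) 0))
  have hbd : ∀ g < k, g * (10 * r) + 10 * r ≤ N := by
    intro g hg
    rw [hN, ← Nat.succ_mul]
    exact Nat.mul_le_mul_right _ hg
  have hFmem : ∀ e, e ∈ F ↔ ∃ g i, g < k ∧ i < r ∧
      s(w (g * (10 * r) + 3 * i) 0, w (g * (10 * r) + 10 * r) 0) = e := by
    intro e
    simp only [F, Finset.mem_image, Finset.mem_product, Finset.mem_range, Prod.exists]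
    constructor
    · rintro ⟨g, i, ⟨h1, h2⟩, h3⟩; exact ⟨g, i, h1, h2, h3⟩
    · rintro ⟨g, i, h1, h2, h3⟩; exact ⟨g, i, ⟨h1, h2⟩, h3⟩
  let G : SimpleGraph V :=
    { Adj := fun u v => u ≠ v ∧ ((φ u ≤ φ v + 1 ∧ φ v ≤ φ u + 1) ∨ s(u, v) ∈ F)
      symm := ⟨by
        rintro u v ⟨h1, h2⟩
        refine ⟨h1.symm, ?_⟩
        rw [Sym2.eq_swap]
        tauto⟩
      loopless := ⟨fun u h => h.1 rfl⟩ }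
  have hadj : ∀ i c j d, w i c ≠ w j d → i ≤ N → c < r → j ≤ N → d < r → i ≤ j + 1 → j ≤ i + 1 →
      G.Adj (w i c) (w j d) := by
    intro i c j d h h1 h2 h3 h4 h5 h6
    refine ⟨h, Or.inl ?_⟩
    rw [hφ i c h1 h2, hφ j d h3 h4]
    exact ⟨h5, h6⟩
  have hch : ∀ g < k, ∀ i < r,
      G.Adj (w (g * (10 * r) + 3 * i) 0) (w (g * (10 * r) + 10 * r) 0) := by
    intro g hg i hi
    have := hbd g hg
    refine ⟨?_, Or.inr ((hFmem _).2 ⟨g, i, hg, hi, rfl⟩)⟩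
    intro h
    have := hw _ _ _ _ (by omega) (by omega) (by omega) (by omega) h
    omega
  have hP : ∀ i, 0 ≤ i → i < 0 + N → (G.deleteEdges (F : Set (Sym2 V))).Adj (w i 0) (w (i+1) 0) := by
    intro i _ hi
    rw [deleteEdges_adj]
    constructor
    · apply hadj <;> try omega
      intro h
      have := hw _ _ _ _ (by omega) (by omega) (by omega) (by omega) h
      omega
    · intro h
      rw [Finset.mem_coe, hFmem] at h
      obtain ⟨g, j, hg, hj, h⟩ := h
      have := hbd g hg
      rw [Sym2.eq_iff] at h
      rcases h with ⟨h1, h2⟩ | ⟨h1, h2⟩ <;>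
      · have e1 := hw _ _ _ _ (by omega) (by omega) (by omega) (by omega) h1
        have e2 := hw _ _ _ _ (by omega) (by omega) (by omega) (by omega) h2
        omega
  obtain ⟨P, hlen, hsup⟩ := aux_path (G.deleteEdges (F : Set (Sym2 V))) (fun i => w i 0) 0 N hP
  refine ⟨G, F, w 0 0, w (0 + N) 0, P, ?_, ?_, ?_, ?_, ?_⟩
  · intro e he
    rw [Finset.mem_coe, hFmem] at he
    obtain ⟨g, j, hg, hj, rfl⟩ := he
    exact hch g hg j hj
  · rw [Set.ncard_coe_finset]
    refine Finset.card_image_le.trans ?_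
    simp
  · rw [Walk.isPath_def, hsup]
    apply List.Nodup.map_on _ List.nodup_range'
    intro x hx y hy h
    simp at hx hy
    exact (hw _ _ _ _ (by omega) (by omega) (by omega) (by omega) h).1
  · intro Q _
    have := aux_pot _ φ (by
      intro u v h
      rw [deleteEdges_adj] at h
      rcases h with ⟨⟨_, h | h⟩, h2⟩
      · exact h.2
      · exact absurd h h2) Q
    rw [hφ _ _ (by omega) (by omega), hφ _ _ (by omega) (by omega)] at this
    omega
  · rintro ⟨ix, h0, hlast, hmono, hrep⟩
    rw [hlen] at hlast
    have hle : ∀ m j, j + m = 2 * k → ix j ≤ N := by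
      intro m
      induction m with
      | zero => intro j hj; rw [← hlast, ← hj]; simp
      | succ m ih =>
        intro j hj
        exact (hmono j (by omega)).trans (ih (j+1) (by omega))
    have hle' : ∀ j, j ≤ 2 * k → ix j ≤ N := fun j hj => hle (2 * k - j) j (by omega)
    have hget : ∀ i, i ≤ N → P.support.getD i (w 0 0) = w i 0 := by
      intro i hi
      rw [hsup, List.getD_eq_getElem _ _ (by simp; omega)]
      simp
    have hrep' : ∀ j, j < 2 * k → IsReplSupp G (r - 2) (w (ix j) 0) (w (ix (j+1)) 0)
        ((List.range' (ix j) (ix (j+1) - ix j + 1)).map (fun i => w i 0)) := by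
      intro j hj
      have h := hrep j hj
      have b1 := hle' j (by omega)
      have b2 := hle' (j+1) (by omega)
      have b3 := hmono j hj
      rw [hget _ b1, hget _ b2] at h
      convert h using 1
      apply List.ext_getElem
      · simp [hsup]; omega
      · intro n h1 h2
        simp [hsup]
    have hind : ∀ g, g ≤ k → ix (2 * g) ≤ g * (10 * r) ∧ (0 < g → ix (2 * g) < g * (10 * r)) := by
      intro g
      induction g with
      | zero => intro _; simp [h0]
      | succ g ih =>
        intro hg
        have ih := (ih (by omega)).1
        have hb := hbd g (by omega)
        have s1 : ix (2 * g + 1) < g * (10 * r) + 3 * (r - 1) := by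
          by_contra hcon
          exact aux_A G N r hr w hw (g * (10 * r)) hb (hch g (by omega)) _ _ ih (by omega)
            (hrep' (2 * g) (by omega))
        have s2 : ix (2 * g + 1 + 1) < g * (10 * r) + 10 * r := by
          by_contra hcon
          exact aux_B G N r hr w hw hadj (g * (10 * r)) hb (hch g (by omega)) _ _ s1.le (by omega)
            (hrep' (2 * g + 1) (by omega))
        have e : 2 * (g + 1) = 2 * g + 1 + 1 := by ring
        have e' : (g + 1) * (10 * r) = g * (10 * r) + 10 * r := Nat.succ_mul _ _
        rw [e, e']
        exact ⟨s2.le, fun _ => s2⟩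
    have := (hind k le_rfl).2 hk
    omega

theorem stmt_3 (k f : ℕ) (hk : 0 < k) (hf : 6 * k ≤ f) :
    ∃ (n : ℕ) (G : SimpleGraph (Fin n)) (F : Set (Sym2 (Fin n))) (s t : Fin n)
      (P : (G.deleteEdges F).Walk s t),
      F ⊆ G.edgeSet ∧ F.ncard ≤ f ∧ P.IsPath ∧
      (∀ Q : (G.deleteEdges F).Walk s t, Q.IsPath → P.length ≤ Q.length) ∧
      ¬ ∃ ix : ℕ → ℕ,
          ix 0 = 0 ∧ ix (2 * k) = P.length ∧
          (∀ j, j < 2 * k → ix j ≤ ix (j + 1)) ∧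
          (∀ j, j < 2 * k →
            IsReplSupp G (f / k - 2)
              (P.support.getD (ix j) s) (P.support.getD (ix (j + 1)) s)
              ((P.support.drop (ix j)).take (ix (j + 1) - ix j + 1))) := by
  have hr : 6 ≤ f / k := (Nat.le_div_iff_mul_le hk).2 hf
  have hkr : k * (f / k) ≤ f := Nat.mul_div_le f k
  generalize f / k = r at hr hkr
  obtain ⟨N, hN⟩ : ∃ N, N = k * (10 * r) := ⟨_, rfl⟩
  have hlt : ∀ i c, i ≤ N → c < r → i * r + c < (N + 1) * r := by
    intro i c hi hc
    have := Nat.mul_le_mul_right r hi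
    rw [Nat.succ_mul]
    omega
  have hpos : 0 < (N + 1) * r := by positivity
  let w : ℕ → ℕ → Fin ((N + 1) * r) := fun i c =>
    ⟨(i * r + c) % ((N + 1) * r), Nat.mod_lt _ hpos⟩
  have hwv : ∀ i c, i ≤ N → c < r → (w i c).val = i * r + c := fun i c hi hc =>
    Nat.mod_eq_of_lt (hlt i c hi hc)
  have hdiv : ∀ i c, c < r → (i * r + c) / r = i := by
    intro i c hc
    rw [Nat.add_comm, Nat.add_mul_div_right _ _ (by omega), Nat.div_eq_of_lt hc, zero_add]
  obtain ⟨G, F, s, t, P, h1, h2, h3⟩ := aux_main_s3 (V := Fin ((N + 1) * r)) k r N hk hr hN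
    (fun u => u.val / r) w
    (by
      intro i c hi hc
      show (w i c).val / r = i
      rw [hwv i c hi hc, hdiv i c hc])
    (by
      intro i c j d hi hc hj hd h
      have h := congrArg Fin.val h
      rw [hwv i c hi hc, hwv j d hj hd] at h
      have e1 := hdiv i c hc
      rw [h, hdiv j d hd] at e1
      subst e1
      exact ⟨rfl, by omega⟩)
  exact ⟨_, G, F, s, t, P, h1, h2.trans hkr, h3⟩
end

section
/- For every integer f ≥ 2, there exist a finite undirected unweighted simple graph G, a set F of at most f edges of G, and a path π that is a shortest path between its endpoints in G∖F, such that π cannot be partitioned into 2 subpaths each of which is an (f−2)-fault replacement path in G; that is, for every vertex x on π, the prefix of π up to x and the suffix of π from x are not both (f−2)-fault replacement paths in G. -/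
open SimpleGraph

theorem aux_walk_s5 {V : Type} (H : SimpleGraph V) (g : ℕ → V) (n : ℕ) : ∀ a : ℕ,
    (∀ k, a ≤ k → k < a + n → H.Adj (g k) (g (k+1))) →
    ∃ p : H.Walk (g a) (g (a+n)), p.length = n ∧ p.support = (List.range' a (n+1)).map g := by
  induction n with
  | zero => intro a _; exact ⟨Walk.nil, rfl, rfl⟩
  | succ n ih =>
    intro a h
    obtain ⟨p, hp, hs⟩ := ih (a+1) (fun k h1 h2 => h k (by omega) (by omega))
    have e : a + 1 + n = a + (n+1) := by omega
    rw [← e]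
    refine ⟨Walk.cons (h a le_rfl (by omega)) p, by simp [hp], ?_⟩
    rw [Walk.support_cons, hs, List.range'_succ (n := n+1)]
    simp

theorem aux_col {V : Type} (H : SimpleGraph V) (g : ℕ → V) (a b : ℕ)
    (h : ∀ k, k < max a b → H.Adj (g k) (g (k+1))) :
    ∃ p : H.Walk (g a) (g b), p.length ≤ max a b := by
  rcases le_total a b with hab | hab
  · obtain ⟨d, rfl⟩ := Nat.exists_eq_add_of_le hab
    obtain ⟨p, hp, _⟩ := aux_walk_s5 H g d a (fun k _ h2 => h k (by omega))
    exact ⟨p, by omega⟩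
  · obtain ⟨d, rfl⟩ := Nat.exists_eq_add_of_le hab
    obtain ⟨p, hp, _⟩ := aux_walk_s5 H g d b (fun k _ h2 => h k (by omega))
    exact ⟨p.reverse, by rw [Walk.length_reverse]; omega⟩

theorem aux_short {V : Type} (H : SimpleGraph V) (u v : V) (supp : List V)
    (h : IsShortestSupp H u v supp) (i j : ℕ) (a b : V) (hij : i ≤ j)
    (hi : supp[i]? = some a) (hj : supp[j]? = some b) (W : H.Walk a b) : j - i ≤ W.length := by
  classical
  obtain ⟨p, rfl, _, hmin⟩ := h
  have hjl : j < p.support.length := by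
    by_contra hc
    rw [List.getElem?_eq_none (by omega)] at hj
    cases hj
  have hl := p.length_support
  have ha : p.getVert i = a := by
    rw [List.getElem?_eq_getElem (by omega)] at hi
    rw [Walk.getVert_eq_support_getElem p (by omega)]
    exact Option.some.inj hi
  have hb : p.getVert j = b := by
    rw [List.getElem?_eq_getElem (by omega)] at hj
    rw [Walk.getVert_eq_support_getElem p (by omega)]
    exact Option.some.inj hj
  subst ha hb
  have h1 := hmin _ ((((p.take i).append W).append (p.drop j)).bypass_isPath)
  have h2 := (((p.take i).append W).append (p.drop j)).length_bypass_le_length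
  rw [Walk.length_append, Walk.length_append, Walk.take_length, Walk.drop_length] at h2
  omega

theorem aux_lip {V : Type} (H : SimpleGraph V) (lev : V → ℕ)
    (h : ∀ u v, H.Adj u v → lev v ≤ lev u + 1) {u v : V} (p : H.Walk u v) :
    lev v ≤ lev u + p.length := by
  induction p with
  | nil => simp
  | cons hadj p ih =>
    have := h _ _ hadj
    rw [Walk.length_cons]; omega

theorem aux_main_s5 (f n L : ℕ) (hf : 2 ≤ f) (hL : L = 6 * f) (lev col : Fin n → ℕ)
    (mk : ℕ → ℕ → Fin n)
    (hlev : ∀ k c, k ≤ L → c < f → lev (mk k c) = k)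
    (hcol : ∀ k c, k ≤ L → c < f → col (mk k c) = c) :
    ∃ (G : SimpleGraph (Fin n)) (F : Set (Sym2 (Fin n))) (s t : Fin n)
      (P : (G.deleteEdges F).Walk s t),
      F ⊆ G.edgeSet ∧ F.ncard ≤ f ∧ P.IsPath ∧
      (∀ Q : (G.deleteEdges F).Walk s t, Q.IsPath → P.length ≤ Q.length) ∧
      ∀ m, m ≤ P.length →
        ¬ (IsReplSupp G (f - 2) s (P.support.getD m s) (P.support.take (m + 1)) ∧
           IsReplSupp G (f - 2) (P.support.getD m s) t (P.support.drop m)) := by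
  classical
  let R : Fin n → Fin n → Prop := fun u v =>
    (col u = col v ∧ lev v = lev u + 1) ∨ (lev u = lev v ∧ col u = 0) ∨
    (∃ i < f, u = mk (3*i) 0 ∧ v = mk L 0)
  let G : SimpleGraph (Fin n) := SimpleGraph.fromRel R
  let e : ℕ → Sym2 (Fin n) := fun i => s(mk (3*i) 0, mk L 0)
  let F : Set (Sym2 (Fin n)) := e '' (Finset.range f : Set ℕ)
  have f0 : 0 < f := by omega
  have hG : ∀ u v, G.Adj u v ↔ u ≠ v ∧ (R u v ∨ R v u) := fun u v => Iff.rfl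
  have heG : ∀ i < f, G.Adj (mk (3*i) 0) (mk L 0) := by
    intro i hi
    refine (hG _ _).2 ⟨fun h => ?_, Or.inl (Or.inr (Or.inr ⟨i, hi, rfl, rfl⟩))⟩
    have := congrArg lev h
    rw [hlev _ _ (by omega) f0, hlev _ _ (by omega) f0] at this
    omega
  have hvert : ∀ k c, k < L → c < f → G.Adj (mk k c) (mk (k+1) c) := by
    intro k c hk hc
    have h1 := hlev k c (by omega) hc
    have h2 := hlev (k+1) c (by omega) hc
    refine (hG _ _).2 ⟨fun h => ?_, Or.inl (Or.inl ⟨?_, by omega⟩)⟩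
    · rw [h] at h1; omega
    · rw [hcol _ _ (by omega) hc, hcol _ _ (by omega) hc]
  have hhor : ∀ k c, k ≤ L → 0 < c → c < f → G.Adj (mk k 0) (mk k c) := by
    intro k c hk hc0 hc
    have h1 := hcol k c (by omega) hc
    have h2 := hcol k 0 (by omega) f0
    refine (hG _ _).2 ⟨fun h => ?_, Or.inl (Or.inr (Or.inl ⟨?_, h2⟩))⟩
    · rw [← h] at h1; omega
    · rw [hlev _ _ (by omega) hc, hlev _ _ (by omega) f0]
  have hlip : ∀ u v, (G.deleteEdges F).Adj u v → lev v ≤ lev u + 1 := by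
    intro u v h
    rw [SimpleGraph.deleteEdges_adj] at h
    obtain ⟨h, hF⟩ := h
    obtain ⟨_, (h | h | ⟨i, hi, rfl, rfl⟩) | (h | h | ⟨i, hi, rfl, rfl⟩)⟩ := (hG _ _).1 h
    · omega
    · omega
    · exact absurd ⟨i, by simpa using hi, rfl⟩ hF
    · omega
    · omega
    · exact absurd ⟨i, by simpa using hi, Sym2.eq_swap⟩ hF
  have hPadj : ∀ k, 0 ≤ k → k < 0 + L → (G.deleteEdges F).Adj (mk k 0) (mk (k+1) 0) := by
    intro k _ hk
    rw [SimpleGraph.deleteEdges_adj]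
    refine ⟨hvert k 0 (by omega) f0, ?_⟩
    rintro ⟨i, hi, he⟩
    have hi' : i < f := by simpa using hi
    have h1 := hlev k 0 (by omega) f0
    have h2 := hlev (k+1) 0 (by omega) f0
    have h3 := hlev (3*i) 0 (by omega) f0
    have h4 := hlev L 0 (by omega) f0
    rcases Sym2.eq_iff.1 he with ⟨ha, hb⟩ | ⟨ha, hb⟩
    · rw [ha] at h3; rw [hb] at h4; omega
    · rw [ha] at h3; rw [hb] at h4; omega
  obtain ⟨P, hPl, hPs⟩ := aux_walk_s5 (G.deleteEdges F) (fun k => mk k 0) L 0 hPadj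
  have hget : ∀ k, k ≤ L → P.support[k]? = some (mk k 0) := by
    intro k hk
    rw [hPs, List.getElem?_map, List.getElem?_range' (by omega)]
    simp
  -- surviving fault edges
  have hsurv : ∀ F' : Set (Sym2 (Fin n)), F'.ncard ≤ f - 2 →
      ∃ i j, i < j ∧ j < f ∧ e i ∉ F' ∧ e j ∉ F' := by
    intro F' hF'
    have hc : ((Finset.range f).filter (fun i => e i ∈ F')).card ≤ f - 2 := by
      refine le_trans ?_ hF'
      rw [← Set.ncard_coe_finset]
      refine Set.ncard_le_ncard_of_injOn e (fun i hi => by simpa using (Finset.mem_filter.1 hi).2) ?_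
        (Set.toFinite _)
      intro i hi j hj hij
      have hi' : i < f := by simpa using (Finset.mem_filter.1 hi).1
      have hj' : j < f := by simpa using (Finset.mem_filter.1 hj).1
      have h3 := hlev (3*i) 0 (by omega) f0
      have h3' := hlev (3*j) 0 (by omega) f0
      have h4 := hlev L 0 (by omega) f0
      rcases Sym2.eq_iff.1 hij with ⟨ha, hb⟩ | ⟨ha, hb⟩
      · rw [ha] at h3; omega
      · rw [ha] at h3; omega
    have hs := Finset.card_filter_add_card_filter_not (s := Finset.range f) (fun i => e i ∈ F')
    rw [Finset.card_range] at hs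
    obtain ⟨i, hi, j, hj, hij⟩ := Finset.one_lt_card.1
      (show 1 < ((Finset.range f).filter (fun i => ¬ e i ∈ F')).card by omega)
    rw [Finset.mem_filter, Finset.mem_range] at hi hj
    rcases lt_or_gt_of_ne hij with h | h
    · exact ⟨i, j, h, hj.1, hi.2, hj.2⟩
    · exact ⟨j, i, h, hi.1, hj.2, hi.2⟩
  -- surviving column
  have hcols : ∀ F' : Set (Sym2 (Fin n)), F' ⊆ G.edgeSet → F'.ncard ≤ f - 2 →
      ∃ c, 0 < c ∧ c < f ∧ ∀ d ∈ F', ∀ v ∈ d, col v ≠ c := by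
    intro F' hsub hF'
    by_contra! hcon
    have hcon' : ∀ c, ∃ d, 0 < c → c < f → d ∈ F' ∧ ∃ v ∈ d, col v = c := by
      intro c
      by_cases h : 0 < c ∧ c < f
      · obtain ⟨d, hd, v, hv, h⟩ := hcon c h.1 h.2
        exact ⟨d, fun _ _ => ⟨hd, v, hv, h⟩⟩
      · exact ⟨e 0, fun h1 h2 => absurd ⟨h1, h2⟩ h⟩
    choose d hd using hcon'
    have key : (Finset.Ico 1 f).card ≤ F'.ncard := by
      rw [← Set.ncard_coe_finset]
      have hI : ∀ c, c ∈ ((Finset.Ico 1 f : Finset ℕ) : Set ℕ) → 0 < c ∧ c < f := by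
        intro c hc
        have := Finset.mem_Ico.1 (Finset.mem_coe.1 hc)
        omega
      refine Set.ncard_le_ncard_of_injOn d (fun c hc => (hd c (hI c hc).1 (hI c hc).2).1) ?_
        (Set.toFinite _)
      intro c hc c' hc' hcc
      obtain ⟨h1, v, hv, hvc⟩ := hd c (hI c hc).1 (hI c hc).2
      obtain ⟨-, w, hw, hwc⟩ := hd c' (hI c' hc').1 (hI c' hc').2
      rw [← hcc] at hw
      have p1 := (hI c hc).1
      have p2 := (hI c' hc').1
      by_contra hne
      have hvw : v ≠ w := by rintro rfl; omega
      have hdd := (Sym2.mem_and_mem_iff hvw).1 ⟨hv, hw⟩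
      have hadj := hsub h1
      rw [hdd, SimpleGraph.mem_edgeSet] at hadj
      have z1 : ∀ i < f, col (mk (3*i) 0) = 0 := fun i hi => hcol _ _ (by omega) f0
      obtain ⟨_, (h | h | ⟨i, hi, h, -⟩) | (h | h | ⟨i, hi, h, -⟩)⟩ := (hG _ _).1 hadj
      · omega
      · omega
      · have := z1 i hi
        rw [← h] at this; omega
      · omega
      · omega
      · have := z1 i hi
        rw [← h] at this; omega
    rw [Nat.card_Ico] at key
    omega
  have hPmin : ∀ Q : (G.deleteEdges F).Walk (mk 0 0) (mk (0+L) 0), P.length ≤ Q.length := by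
    intro Q
    have := aux_lip _ lev hlip Q
    rw [hlev _ _ (by omega) f0, hlev _ _ (by omega) f0] at this
    omega
  refine ⟨G, F, _, _, P, ?_, ?_, ?_, fun Q _ => hPmin Q, ?_⟩
  · rintro _ ⟨i, hi, rfl⟩
    exact heG i (by simpa using hi)
  · calc F.ncard ≤ ((Finset.range f : Finset ℕ) : Set ℕ).ncard :=
          Set.ncard_image_le (Set.toFinite _)
      _ = f := by rw [Set.ncard_coe_finset, Finset.card_range]
  · rw [Walk.isPath_def, hPs]
    refine List.Nodup.map_on ?_ (List.nodup_range')
    intro x hx y hy hxy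
    rw [List.mem_range'_1] at hx hy
    have := congrArg lev hxy
    rwa [hlev _ _ (by omega) f0, hlev _ _ (by omega) f0] at this
  · intro m hm
    rw [hPl] at hm
    have hgd : P.support.getD m (mk 0 0) = mk m 0 := by
      rw [List.getD_eq_getElem?_getD, hget m hm]; rfl
    rintro ⟨⟨F1, hF1, hF1c, hS1⟩, ⟨F2, hF2, hF2c, hS2⟩⟩
    by_cases hmf : 3 * (f - 1) ≤ m
    · obtain ⟨i, j, hij, hj, hei, hej⟩ := hsurv F1 hF1c
      have ai : (G.deleteEdges F1).Adj (mk (3*i) 0) (mk L 0) :=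
        SimpleGraph.deleteEdges_adj.2 ⟨heG i (by omega), hei⟩
      have aj : (G.deleteEdges F1).Adj (mk (3*j) 0) (mk L 0) :=
        SimpleGraph.deleteEdges_adj.2 ⟨heG j (by omega), hej⟩
      have := aux_short _ _ _ _ hS1 (3*i) (3*j) (mk (3*i) 0) (mk (3*j) 0) (by omega)
        (by rw [List.getElem?_take_of_lt (by omega)]; exact hget _ (by omega))
        (by rw [List.getElem?_take_of_lt (by omega)]; exact hget _ (by omega))
        (Walk.cons ai (Walk.cons aj.symm Walk.nil))
      simp only [Walk.length_cons, Walk.length_nil] at this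
      omega
    · obtain ⟨i, j, hij, hj, hei, hej⟩ := hsurv F2 hF2c
      obtain ⟨c, hc0, hc, hcF⟩ := hcols F2 hF2 hF2c
      have ai : (G.deleteEdges F2).Adj (mk (3*i) 0) (mk L 0) :=
        SimpleGraph.deleteEdges_adj.2 ⟨heG i (by omega), hei⟩
      have ah : ∀ k, k ≤ L → (G.deleteEdges F2).Adj (mk k 0) (mk k c) := fun k hk =>
        SimpleGraph.deleteEdges_adj.2 ⟨hhor k c hk hc0 hc, fun h =>
          hcF _ h (mk k c) (Sym2.mem_mk_right _ _) (hcol _ _ hk hc)⟩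
      have av : ∀ k, k < L → (G.deleteEdges F2).Adj (mk k c) (mk (k+1) c) := fun k hk =>
        SimpleGraph.deleteEdges_adj.2 ⟨hvert k c hk hc, fun h =>
          hcF _ h (mk k c) (Sym2.mem_mk_left _ _) (hcol _ _ hk.le hc)⟩
      obtain ⟨W, hW⟩ := aux_col (G.deleteEdges F2) (fun k => mk k c) m (3*i)
        (fun k hk => av k (by omega))
      have := aux_short _ _ _ _ hS2 0 (L - m) (mk m 0) (mk L 0) (by omega)
        (by rw [List.getElem?_drop]; exact hget _ (by omega))
        (by rw [List.getElem?_drop, Nat.add_sub_cancel' hm]; exact hget _ (by omega))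
        (Walk.cons (ah m hm) (W.append (Walk.cons (ah (3*i) (by omega)).symm
          (Walk.cons ai Walk.nil))))
      simp only [Walk.length_cons, Walk.length_nil, Walk.length_append] at this
      omega

/-- for every `f ≥ 2` there are a finite simple graph `G`, a set `F` of at
most `f` edges of `G`, and a shortest path `P` in `G \ F`, such that for every vertex `x`
on `P` (given by its position `m` in the vertex sequence of `P`), the prefix of `P` up to
`x` and the suffix of `P` from `x` are not both `(f - 2)`-fault replacement paths in `G`. -/
theorem stmt_5 (f : ℕ) (hf : 2 ≤ f) :
    ∃ (n : ℕ) (G : SimpleGraph (Fin n)) (F : Set (Sym2 (Fin n))) (s t : Fin n)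
      (P : (G.deleteEdges F).Walk s t),
      F ⊆ G.edgeSet ∧ F.ncard ≤ f ∧ P.IsPath ∧
      (∀ Q : (G.deleteEdges F).Walk s t, Q.IsPath → P.length ≤ Q.length) ∧
      ∀ m, m ≤ P.length →
        ¬ (IsReplSupp G (f - 2) s (P.support.getD m s) (P.support.take (m + 1)) ∧
           IsReplSupp G (f - 2) (P.support.getD m s) t (P.support.drop m)) := by
  let g : Fin ((6*f+1) * f) → Fin (6*f+1) × Fin f := finProdFinEquiv.symm
  refine ⟨(6*f+1) * f, ?_⟩
  refine aux_main_s5 f _ (6*f) hf rfl (fun v => (g v).1.val) (fun v => (g v).2.val)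
    (fun k c => finProdFinEquiv (Fin.ofNat _ k, ⟨c % f, Nat.mod_lt _ (by omega)⟩)) ?_ ?_
  · intro k c hk hc
    simp only [g, Equiv.symm_apply_apply, Fin.val_ofNat]
    exact Nat.mod_eq_of_lt (by omega)
  · intro k c hk hc
    simp only [g, Equiv.symm_apply_apply]
    exact Nat.mod_eq_of_lt hc
end

section
/- Let G be a finite undirected simple graph with positive real edge weights, let f be a positive integer, let F be a set of at most f edges of G, let π be a minimum-weight path between its endpoints in G∖F, and let k be a positive integer with k ≤ f. Then π admits a decomposition π = π_0 ∘ e_0 ∘ π_1 ∘ e_1 ∘ … ∘ e_{q−2} ∘ π_{q−1} with q ≤ 8k+1, where the π_i are (possibly empty) consecutive subpaths of π interleaved with single edges e_i of π, and for each i there exists a set F_i ⊆ F with k·|F_i| ≤ f (that is, |F_i| ≤ f/k) such that π_i is a minimum-weight path between its endpoints in G∖F_i. -/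
open SimpleGraph

/-- `supp` is the vertex list of a minimum-weight `u`–`v` path in the graph `H` with
edge weights `w` (minimum total weight among all `u`–`v` paths). -/
def IsMinWtSupp {V : Type} (H : SimpleGraph V) (w : Sym2 V → ℝ) (u v : V)
    (supp : List V) : Prop :=
  ∃ p : H.Walk u v, p.support = supp ∧ p.IsPath ∧
    ∀ q : H.Walk u v, q.IsPath → (p.edges.map w).sum ≤ (q.edges.map w).sum


namespace Resto

open scoped ENNReal

/-- extended weight of an edge list -/
noncomputable def LW {V : Type} (w : Sym2 V → ℝ) (L : List (Sym2 V)) : ℝ≥0∞ :=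
  (L.map (fun e => ENNReal.ofReal (w e))).sum

theorem LW_append {V : Type} (w : Sym2 V → ℝ) (L M : List (Sym2 V)) :
    LW w (L ++ M) = LW w L + LW w M := by simp [LW]

theorem LW_cons {V : Type} (w : Sym2 V → ℝ) (e) (M : List (Sym2 V)) :
    LW w (e :: M) = ENNReal.ofReal (w e) + LW w M := by simp [LW]

theorem LW_nil {V : Type} (w : Sym2 V → ℝ) : LW w [] = 0 := by simp [LW]

theorem LW_eq {V : Type} (w : Sym2 V → ℝ) (L : List (Sym2 V)) (h : ∀ e ∈ L, 0 < w e) :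
    LW w L = ENNReal.ofReal (L.map w).sum ∧ 0 ≤ (L.map w).sum := by
  induction L with
  | nil => simp [LW]
  | cons a L ih =>
    obtain ⟨h1, h2⟩ := ih (fun e he => h e (by simp [he]))
    have ha := h a (by simp)
    rw [LW_cons, h1, List.map_cons, List.sum_cons, ENNReal.ofReal_add ha.le h2]
    exact ⟨rfl, by linarith⟩

theorem LW_ne_top {V : Type} (w : Sym2 V → ℝ) (L : List (Sym2 V)) : LW w L ≠ ⊤ := by
  induction L with
  | nil => simp [LW]
  | cons a L ih => rw [LW_cons]; simp [ih]

/-- extended distance -/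
noncomputable def wd {V : Type} (H : SimpleGraph V) (w : Sym2 V → ℝ) (a b : V) : ℝ≥0∞ :=
  ⨅ p : H.Walk a b, LW w p.edges

theorem wd_le {V : Type} {H : SimpleGraph V} (w : Sym2 V → ℝ) {a b : V} (p : H.Walk a b) :
    wd H w a b ≤ LW w p.edges := iInf_le _ p

theorem wd_self {V : Type} (H : SimpleGraph V) (w : Sym2 V → ℝ) (a : V) : wd H w a a = 0 := by
  have := wd_le (H := H) w (Walk.nil (u := a))
  simpa [LW] using this

theorem wd_tri {V : Type} (H : SimpleGraph V) (w : Sym2 V → ℝ) (a b c : V) :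
    wd H w a c ≤ wd H w a b + wd H w b c := by
  unfold wd
  rw [ENNReal.iInf_add]
  refine le_iInf fun p => ?_
  rw [ENNReal.add_iInf]
  refine le_iInf fun q => ?_
  rw [← LW_append, ← Walk.edges_append]
  exact iInf_le _ (p.append q)

theorem wd_symm_le {V : Type} (H : SimpleGraph V) (w : Sym2 V → ℝ) (a b : V) :
    wd H w a b ≤ wd H w b a := by
  refine le_iInf fun p => (wd_le w p.reverse).trans (le_of_eq ?_)
  simp [LW]

/-- walks in `G \ F'` -/
theorem walk_split {V : Type} (G : SimpleGraph V) (w : Sym2 V → ℝ) (F F' : Set (Sym2 V))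
    {a b : V} (Q : (G.deleteEdges F').Walk a b) :
    wd (G.deleteEdges F) w a b ≤ LW w Q.edges ∨
    ∃ e ∈ F, e ∉ F' ∧ ∃ u ∈ e, ∃ e' ∈ F, e' ∉ F' ∧ ∃ v ∈ e',
      wd (G.deleteEdges F) w a u + wd (G.deleteEdges F) w v b ≤ LW w Q.edges := by
  induction Q with
  | nil => left; rw [wd_self]; exact zero_le
  | @cons a c b h Q ih =>
    rw [Walk.edges_cons, LW_cons]
    have h' := h
    rw [deleteEdges_adj] at h'
    by_cases hF : s(a, c) ∈ F
    · right
      rcases ih with ih | ⟨e, he, he', u, hu, e', hee, hee', v, hv, ih⟩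
      · refine ⟨_, hF, h'.2, a, by simp, _, hF, h'.2, c, by simp, ?_⟩
        rw [wd_self, zero_add]
        exact ih.trans le_add_self
      · refine ⟨_, hF, h'.2, a, by simp, e', hee, hee', v, hv, ?_⟩
        rw [wd_self, zero_add]
        exact (le_add_self.trans ih).trans le_add_self
    · have hac : (G.deleteEdges F).Adj a c := by rw [deleteEdges_adj]; exact ⟨h'.1, hF⟩
      have hd : wd (G.deleteEdges F) w a c ≤ ENNReal.ofReal (w s(a, c)) := by
        have := wd_le w (Walk.cons hac Walk.nil)
        simpa [LW] using this
      rcases ih with ih | ⟨e, he, he', u, hu, e', hee, hee', v, hv, ih⟩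
      · left
        exact (wd_tri _ w a c b).trans (add_le_add hd ih)
      · right
        refine ⟨e, he, he', u, hu, e', hee, hee', v, hv, ?_⟩
        calc _ ≤ (wd (G.deleteEdges F) w a c + wd (G.deleteEdges F) w c u)
              + wd (G.deleteEdges F) w v b := by gcongr; exact wd_tri _ w a c u
          _ = wd (G.deleteEdges F) w a c + (wd (G.deleteEdges F) w c u
              + wd (G.deleteEdges F) w v b) := add_assoc _ _ _
          _ ≤ _ := add_le_add hd ih

theorem seg {V : Type} {H : SimpleGraph V} {s t : V} (P : H.Walk s t) (hP : P.IsPath)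
    (l r : ℕ) (hlr : l ≤ r) (hr : r ≤ P.length) :
    ∃ p : H.Walk (P.getVert l) (P.getVert r),
      p.support = (P.support.drop l).take (r - l + 1) ∧
      p.edges = (P.edges.drop l).take (r - l) ∧ p.IsPath := by
  refine ⟨((P.drop l).take (r - l)).copy rfl (by rw [Walk.drop_getVert]; congr 1; omega),
    ?_, ?_, ?_⟩
  · rw [Walk.support_copy, Walk.support_take, Walk.drop_support_eq_support_drop_min,
      min_eq_left (hlr.trans hr)]
  · rw [Walk.edges_copy, Walk.edges_take, Walk.edges_drop]
  · rw [Walk.isPath_copy]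
    exact (hP.drop l).take _

/-- length of the segment from position `l` to position `r` -/
noncomputable def SL {V : Type} {H : SimpleGraph V} (w : Sym2 V → ℝ) {s t : V} (P : H.Walk s t)
    (l r : ℕ) : ℝ≥0∞ := LW w ((P.edges.drop l).take (r - l))

theorem SL_add {V : Type} {H : SimpleGraph V} (w : Sym2 V → ℝ) {s t : V} (P : H.Walk s t)
    (a b c : ℕ) (hab : a ≤ b) (hbc : b ≤ c) : SL w P a c = SL w P a b + SL w P b c := by
  unfold SL
  rw [← LW_append]
  congr 1
  obtain ⟨x, rfl⟩ := Nat.exists_eq_add_of_le hab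
  obtain ⟨y, rfl⟩ := Nat.exists_eq_add_of_le hbc
  rw [show a + x + y - a = x + y by omega, show a + x - a = x by omega,
    show a + x + y - (a + x) = y by omega, List.take_add, List.drop_drop]

theorem wd_seg {V : Type} {H : SimpleGraph V} (w : Sym2 V → ℝ) {s t : V} (P : H.Walk s t)
    (hP : P.IsPath) (hs : ∀ Q : H.Walk s t, LW w P.edges ≤ LW w Q.edges)
    (l r : ℕ) (hlr : l ≤ r) (hr : r ≤ P.length) :
    wd H w (P.getVert l) (P.getVert r) = SL w P l r := by
  apply le_antisymm
  · obtain ⟨p, -, he, -⟩ := seg P hP l r hlr hr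
    exact (wd_le w p).trans (le_of_eq (by rw [he, SL]))
  · refine le_iInf fun Q => ?_
    have h := hs (((P.take l).append Q).append (P.drop r))
    rw [Walk.edges_append, Walk.edges_append, LW_append, LW_append, Walk.edges_take,
      Walk.edges_drop] at h
    have h0 : LW w P.edges = SL w P 0 P.length := by
      unfold SL
      rw [List.drop_zero, List.take_of_length_le (by simp)]
    have h1 : LW w (P.edges.take l) = SL w P 0 l := by unfold SL; simp
    have h2 : LW w (P.edges.drop r) = SL w P r P.length := by
      unfold SL
      rw [List.take_of_length_le (by simp)]
    rw [h0, h1, h2, SL_add w P 0 r _ (by omega) hr, SL_add w P 0 l r (by omega) hlr] at h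
    have h3 := (ENNReal.add_le_add_iff_right (LW_ne_top w _)).1 h
    exact (ENNReal.add_le_add_iff_left (LW_ne_top w _)).1 h3

theorem exists_rad {ι α : Type*} [LinearOrder α] (T : Finset ι) (g : ι → α) (h : ℕ)
    (h0 : 0 < h) (hT : h ≤ T.card) :
    ∃ r, h ≤ (T.filter (fun x => g x ≤ r)).card ∧ (T.filter (fun x => g x < r)).card < h := by
  classical
  set S := (T.image g).filter (fun r => h ≤ (T.filter (fun x => g x ≤ r)).card) with hS
  have hTne : T.Nonempty := by
    rw [← Finset.card_pos]; omega
  have hne : S.Nonempty := by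
    obtain ⟨m, hm, hmax⟩ := T.exists_max_image g hTne
    refine ⟨g m, ?_⟩
    rw [hS, Finset.mem_filter]
    refine ⟨Finset.mem_image_of_mem g hm, ?_⟩
    rw [Finset.filter_true_of_mem hmax]
    exact hT
  refine ⟨S.min' hne, ?_, ?_⟩
  · have := S.min'_mem hne
    exact (Finset.mem_filter.1 this).2
  · by_contra hcon
    push Not at hcon
    set A := T.filter (fun x => g x < S.min' hne) with hA
    have hAne : A.Nonempty := by
      rw [← Finset.card_pos]; omega
    obtain ⟨m, hm, hmax⟩ := A.exists_max_image g hAne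
    have hm' := hm
    rw [hA, Finset.mem_filter] at hm'
    have : g m ∈ S := by
      rw [hS, Finset.mem_filter]
      refine ⟨Finset.mem_image_of_mem g hm'.1, hcon.trans (Finset.card_le_card ?_)⟩
      intro x hx
      rw [Finset.mem_filter]
      exact ⟨(Finset.mem_filter.1 hx).1, hmax x hx⟩
    exact absurd (S.min'_le _ this) (not_le.2 hm'.2)

theorem greedy (n : ℕ) (good : ℕ → ℕ → Prop) (hg : ∀ a, a ≤ n → good a a) (m : ℕ) :
    ∀ a, a ≤ n →
    (∃ (q : ℕ) (l r : ℕ → ℕ), 1 ≤ q ∧ q ≤ m ∧ l 0 = a ∧ r (q - 1) = n ∧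
      (∀ i, i ≤ q - 1 → l i ≤ r i) ∧
      (∀ i, i < q - 1 → r i < n ∧ l (i + 1) = r i + 1) ∧
      (∀ i, i ≤ q - 1 → good (l i) (r i))) ∨
    (∃ z : ℕ → ℕ, z 0 = a ∧ z m ≤ n ∧ ∀ i < m, z i < z (i + 1) ∧ ¬ good (z i) (z (i + 1))) := by
  induction m with
  | zero => intro a ha; right; exact ⟨fun _ => a, rfl, ha, by simp⟩
  | succ m ih =>
    intro a ha
    by_cases han : good a n
    · left
      refine ⟨1, fun _ => a, fun _ => n, le_rfl, by omega, rfl, rfl, fun _ _ => ha, ?_,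
        fun _ _ => han⟩
      intro i hi; omega
    · classical
      have hex : ∃ d, ¬ good a (a + d) := ⟨n - a, by rwa [Nat.add_sub_cancel' ha]⟩
      set d := Nat.find hex with hd
      have hd1 : ¬ good a (a + d) := Nat.find_spec hex
      have hd0 : d ≠ 0 := by
        intro h0; rw [h0] at hd1; exact hd1 (hg a ha)
      have hdn : a + d ≤ n := by
        have : d ≤ n - a := Nat.find_min' hex (by rwa [Nat.add_sub_cancel' ha])
        omega
      have hd2 : good a (a + (d - 1)) := by
        by_contra hc
        exact Nat.find_min hex (m := d - 1) (by omega) hc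
      rcases ih (a + d) hdn with ⟨q, l, r, h1, h2, h3, h4, h5, h6, h7⟩ | ⟨z, h1, h2, h3⟩
      · left
        refine ⟨q + 1, fun i => if i = 0 then a else l (i - 1),
          fun i => if i = 0 then a + (d - 1) else r (i - 1), by omega, by omega, by simp, ?_, ?_,
          ?_, ?_⟩
        · have hq : q ≠ 0 := by omega
          simpa [hq] using h4
        · rintro (_ | i) hi
          · simp
          · simpa using h5 i (by omega)
        · rintro (_ | i) hi
          · simp [h3]; omega
          · have := h6 i (by omega)
            simpa using ⟨this.1, this.2⟩
        · rintro (_ | i) hi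
          · simpa using hd2
          · simpa using h7 i (by omega)
      · right
        refine ⟨fun i => if i = 0 then a else z (i - 1), by simp, by simpa using h2, ?_⟩
        rintro (_ | i) hi
        · simp only [if_true]
          simp [h1, hd1]; omega
        · simpa using h3 i (by omega)

end Resto

/-- weighted restoration lemma, multiplicative form: let `G` be a finite
simple graph with positive real edge weights `w`, `F` a set of at most `f` edges, `P` a
minimum-weight path in `G \ F`, and `1 ≤ k ≤ f`. Then `P` decomposes as
`π_0 ∘ e_0 ∘ π_1 ∘ e_1 ∘ ⋯ ∘ e_{q-2} ∘ π_{q-1}` with `q ≤ 8k + 1`, where subpath `π_i`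
occupies positions `l i` to `r i` of `P` (possibly empty) and `e_i` is the single edge
of `P` from position `r i` to `r i + 1 = l (i+1)`, such that for each `i` there is
`F_i ⊆ F` with `k * |F_i| ≤ f` (i.e. `|F_i| ≤ f / k`) for which `π_i` is a minimum-weight
path between its endpoints in `G \ F_i`. -/
theorem stmt_7 {V : Type} [Fintype V] (G : SimpleGraph V)
    (w : Sym2 V → ℝ) (hw : ∀ e ∈ G.edgeSet, 0 < w e)
    (f : ℕ) (hf : 0 < f)
    (F : Set (Sym2 V)) (hFE : F ⊆ G.edgeSet) (hFcard : F.ncard ≤ f)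
    (k : ℕ) (hk1 : 0 < k) (hkf : k ≤ f)
    (s t : V) (P : (G.deleteEdges F).Walk s t)
    (hPpath : P.IsPath)
    (hPshort : ∀ Q : (G.deleteEdges F).Walk s t, Q.IsPath →
      (P.edges.map w).sum ≤ (Q.edges.map w).sum) :
    ∃ (q : ℕ) (l r : ℕ → ℕ),
      1 ≤ q ∧ q ≤ 8 * k + 1 ∧
      l 0 = 0 ∧ r (q - 1) = P.length ∧
      (∀ i, i ≤ q - 1 → l i ≤ r i) ∧
      (∀ i, i < q - 1 → r i < P.length ∧ l (i + 1) = r i + 1) ∧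
      (∀ i, i ≤ q - 1 →
        ∃ Fi : Set (Sym2 V), Fi ⊆ F ∧ k * Fi.ncard ≤ f ∧
          IsMinWtSupp (G.deleteEdges Fi) w
            (P.support.getD (l i) s) (P.support.getD (r i) s)
            ((P.support.drop (l i)).take (r i - l i + 1))) := by
  classical
  have hFfin : F.Finite := Set.toFinite F
  have hposH : ∀ (F' : Set (Sym2 V)) (a b : V) (Q : (G.deleteEdges F').Walk a b),
      ∀ e ∈ Q.edges, 0 < w e := by
    intro F' a b Q e he
    have := Q.edges_subset_edgeSet he
    rw [edgeSet_deleteEdges] at this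
    exact hw e this.1
  have hs : ∀ Q : (G.deleteEdges F).Walk s t, Resto.LW w P.edges ≤ Resto.LW w Q.edges := by
    intro Q
    have h1 := hPshort Q.bypass Q.bypass_isPath
    have h2 : Resto.LW w Q.bypass.edges ≤ Resto.LW w Q.edges := by
      unfold Resto.LW
      exact List.Sublist.sum_le_sum (Q.edges_bypass_sublist_edges.map _) (by simp)
    refine le_trans ?_ h2
    rw [(Resto.LW_eq w _ (hposH F _ _ P)).1, (Resto.LW_eq w _ (hposH F _ _ Q.bypass)).1]
    exact ENNReal.ofReal_le_ofReal h1
  have hgetD : ∀ i, i ≤ P.length → P.support.getD i s = P.getVert i := by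
    intro i hi
    rw [List.getD_eq_getElem _ _ (by rw [Walk.length_support]; omega),
      Walk.support_getElem_eq_getVert]
  -- the goodness predicate
  set good : ℕ → ℕ → Prop := fun l r => ∃ Fi : Set (Sym2 V), Fi ⊆ F ∧ k * Fi.ncard ≤ f ∧
          IsMinWtSupp (G.deleteEdges Fi) w
            (P.support.getD l s) (P.support.getD r s)
            ((P.support.drop l).take (r - l + 1)) with hgood
  have good_of : ∀ l r, l ≤ r → r ≤ P.length → ∀ Fi : Set (Sym2 V), Fi ⊆ F →
      k * Fi.ncard ≤ f →
      (∀ Q : (G.deleteEdges Fi).Walk (P.getVert l) (P.getVert r),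
        Resto.SL w P l r ≤ Resto.LW w Q.edges) → good l r := by
    intro l r hlr hr Fi hFi hcard hQ
    refine ⟨Fi, hFi, hcard, ?_⟩
    rw [hgetD l (hlr.trans hr), hgetD r hr]
    obtain ⟨p, hp1, hp2, hp3⟩ := Resto.seg P hPpath l r hlr hr
    have hle : (G.deleteEdges F) ≤ G.deleteEdges Fi := deleteEdges_anti hFi
    refine ⟨p.mapLe hle, ?_, ?_, ?_⟩
    · rw [Walk.support_mapLe_eq_support, hp1]
    · exact hp3.mapLe hle
    · intro q _
      have h1 := hQ q
      rw [Resto.SL, ← hp2, ← Walk.edges_mapLe_eq_edges hle p,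
        (Resto.LW_eq w _ (hposH Fi _ _ (p.mapLe hle))).1,
        (Resto.LW_eq w _ (hposH Fi _ _ q)).1] at h1
      exact (ENNReal.ofReal_le_ofReal_iff (Resto.LW_eq w _ (hposH Fi _ _ q)).2).1 h1
  have hgg : ∀ a, a ≤ P.length → good a a := by
    intro a ha
    refine good_of a a le_rfl ha ∅ (Set.empty_subset _) (by simp) ?_
    intro Q
    simp [Resto.SL, Resto.LW]
  rcases Resto.greedy P.length good hgg (8 * k + 1) 0 (Nat.zero_le _) with h | ⟨z, hz0, hzm, hz⟩
  · exact h
  exfalso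
  have hmono : ∀ i j, i ≤ j → j ≤ 8 * k + 1 → z i ≤ z j := by
    intro i j hij
    induction j, hij using Nat.le_induction with
    | base => intro _; exact le_rfl
    | succ j hj ih => intro h; exact (ih (by omega)).trans (hz j (by omega)).1.le
  have hzn : ∀ i, i ≤ 8 * k + 1 → z i ≤ P.length := fun i hi =>
    (hmono i _ hi le_rfl).trans hzm
  -- darts
  set h := f / (2 * k) + 1 with hh
  have hh1 : f < 2 * k * h := Nat.lt_mul_div_succ f (by omega)
  have hh2 : 2 * k * (h - 1) ≤ f := by rw [hh, Nat.add_sub_cancel]; exact Nat.mul_div_le f (2 * k)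
  set T : Finset ((_ : Sym2 V) × V) := hFfin.toFinset.sigma (fun e => e.toFinset) with hT
  have hmemT : ∀ e v, (⟨e, v⟩ : (_ : Sym2 V) × V) ∈ T ↔ e ∈ F ∧ v ∈ e := by
    intro e v; simp [hT]
  have hTcard : T.card ≤ 2 * f := by
    rw [hT, Finset.card_sigma]
    calc _ ≤ ∑ e ∈ hFfin.toFinset, 2 := Finset.sum_le_sum fun e _ => by
            rw [Sym2.card_toFinset]; split_ifs <;> omega
      _ = 2 * F.ncard := by rw [Finset.sum_const, Set.ncard_eq_toFinset_card F hFfin]; simp [mul_comm]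
      _ ≤ _ := by omega
  have hbig : h ≤ T.card := by
    by_contra hlt
    push Not at hlt
    refine (hz 0 (by omega)).2 (good_of _ _ (hz 0 (by omega)).1.le (hzn _ (by omega)) F le_rfl ?_ ?_)
    · have : F.ncard ≤ T.card := by
        rw [hT, Finset.card_sigma, Set.ncard_eq_toFinset_card F hFfin, Finset.card_eq_sum_ones]
        exact Finset.sum_le_sum fun e _ => by
            rw [Sym2.card_toFinset]; split_ifs <;> omega
      have h3 : k * F.ncard ≤ k * (h - 1) := Nat.mul_le_mul_left _ (by omega)
      have h4 : 2 * k * (h - 1) = 2 * (k * (h - 1)) := by ring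
      omega
    · intro Q
      rw [← Resto.wd_seg w P hPpath hs _ _ (hz 0 (by omega)).1.le (hzn _ (by omega))]
      exact Resto.wd_le w Q
  have hhpos : 0 < h := Nat.succ_pos _
  have hrad := fun x : V => Resto.exists_rad T (fun y => Resto.wd (G.deleteEdges F) w x y.2) h hhpos hbig
  choose ψ hψ1 hψ2 using hrad
  have hbad : ∀ i < 8 * k + 1,
      ψ (P.getVert (z i)) + ψ (P.getVert (z (i + 1))) < Resto.SL w P (z i) (z (i + 1)) := by
    intro i hi
    by_contra hcon
    push Not at hcon
    set A := T.filter (fun y => Resto.wd (G.deleteEdges F) w (P.getVert (z i)) y.2 < ψ (P.getVert (z i))) with hA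
    set B := T.filter (fun y => Resto.wd (G.deleteEdges F) w (P.getVert (z (i+1))) y.2 < ψ (P.getVert (z (i+1)))) with hB
    have hAc : A.card < h := hψ2 _
    have hBc : B.card < h := hψ2 _
    set Fi : Finset (Sym2 V) := (A ∪ B).image Sigma.fst with hFi
    have hFic : Fi.card ≤ 2 * (h - 1) := by
      have h1 : Fi.card ≤ (A ∪ B).card := Finset.card_image_le
      have h2 := Finset.card_union_le A B
      omega
    refine (hz i hi).2 (good_of _ _ (hz i hi).1.le (hzn _ (by omega)) (Fi : Set (Sym2 V)) ?_ ?_ ?_)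
    · intro e he
      rw [hFi, Finset.mem_coe, Finset.mem_image] at he
      obtain ⟨⟨e', v⟩, hx, rfl⟩ := he
      rw [Finset.mem_union, hA, hB, Finset.mem_filter, Finset.mem_filter] at hx
      have : (⟨e', v⟩ : (_ : Sym2 V) × V) ∈ T := by tauto
      exact ((hmemT _ _).1 this).1
    · rw [Set.ncard_coe_finset]
      have h3 : k * Fi.card ≤ k * (2 * (h - 1)) := Nat.mul_le_mul_left _ hFic
      have h4 : 2 * k * (h - 1) = k * (2 * (h - 1)) := by ring
      omega
    · intro Q
      rcases Resto.walk_split G w F _ Q with hQ | ⟨e, he, he', u, hu, e', hee, hee', v, hv, hQ⟩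
      · rw [← Resto.wd_seg w P hPpath hs _ _ (hz i hi).1.le (hzn _ (by omega))]
        exact hQ
      · refine hcon.trans (le_trans (add_le_add ?_ ?_) hQ)
        · by_contra hlt
          push Not at hlt
          apply he'
          rw [hFi, Finset.mem_coe, Finset.mem_image]
          refine ⟨⟨e, u⟩, Finset.mem_union_left _ ?_, rfl⟩
          rw [hA, Finset.mem_filter]
          exact ⟨(hmemT _ _).2 ⟨he, hu⟩, hlt⟩
        · by_contra hlt
          push Not at hlt
          apply hee'
          rw [hFi, Finset.mem_coe, Finset.mem_image]
          refine ⟨⟨e', v⟩, Finset.mem_union_right _ ?_, rfl⟩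
          rw [hB, Finset.mem_filter]
          exact ⟨(hmemT _ _).2 ⟨hee, hv⟩, (Resto.wd_symm_le _ w _ _).trans_lt hlt⟩
  have hsep : ∀ i j, i < j → j ≤ 8 * k + 1 →
      ψ (P.getVert (z i)) + ψ (P.getVert (z j)) < Resto.wd (G.deleteEdges F) w (P.getVert (z i)) (P.getVert (z j)) := by
    intro i j hij hj
    rw [Resto.wd_seg w P hPpath hs _ _ (hmono i j hij.le hj) (hzn _ hj)]
    obtain ⟨j, rfl⟩ : ∃ j', j = j' + 1 := ⟨j - 1, by omega⟩
    rcases Nat.lt_or_ge i j with hlt | hge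
    · rw [Resto.SL_add w P _ (z (i + 1)) _ (hz i (by omega)).1.le (hmono _ _ (by omega) hj),
        Resto.SL_add w P (z (i + 1)) (z j) _ (hmono _ _ (by omega) (by omega)) (hz j (by omega)).1.le]
      have h1 := lt_of_le_of_lt le_self_add (hbad i (by omega))
      have h2 := lt_of_le_of_lt le_add_self (hbad j (by omega))
      refine (ENNReal.add_lt_add h1 h2).trans_le ?_
      gcongr
      exact le_add_self
    · obtain rfl : i = j := by omega
      exact hbad i (by omega)
  set C : ℕ → Finset ((_ : Sym2 V) × V) := fun i =>
    T.filter (fun y => Resto.wd (G.deleteEdges F) w (P.getVert (z i)) y.2 ≤ ψ (P.getVert (z i))) with hC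
  have hdisj' : ∀ i j, i < j → j ≤ 8 * k + 1 → Disjoint (C i) (C j) := by
    intro i j hij hj
    rw [Finset.disjoint_left]
    intro y hy1 hy2
    have h1 := (Finset.mem_filter.1 hy1).2
    have h2 := (Finset.mem_filter.1 hy2).2
    have h3 := Resto.wd_tri (G.deleteEdges F) w (P.getVert (z i)) y.2 (P.getVert (z j))
    have h4 := (Resto.wd_symm_le (G.deleteEdges F) w y.2 (P.getVert (z j))).trans h2
    exact absurd (h3.trans (add_le_add h1 h4)) (not_le.2 (hsep i j hij hj))
  have hcount : (8 * k + 1) * h ≤ T.card := by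
    have hd : ((Finset.range (8 * k + 1) : Finset ℕ) : Set ℕ).PairwiseDisjoint C := by
      intro i hi j hj hij
      have hi' : i < 8 * k + 1 := by simpa using hi
      have hj' : j < 8 * k + 1 := by simpa using hj
      rcases lt_or_gt_of_ne hij with hlt | hlt
      · exact hdisj' i j hlt (by omega)
      · exact (hdisj' j i hlt (by omega)).symm
    calc (8 * k + 1) * h = ∑ i ∈ Finset.range (8 * k + 1), h := by simp
      _ ≤ ∑ i ∈ Finset.range (8 * k + 1), (C i).card := Finset.sum_le_sum fun i _ => hψ1 _
      _ = ((Finset.range (8 * k + 1)).biUnion C).card := (Finset.card_biUnion hd).symm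
      _ ≤ T.card := Finset.card_le_card (Finset.biUnion_subset.2 fun i _ => Finset.filter_subset _ _)
  nlinarith
end

section
/- Let π' be a subpath of π with endpoints x and y, and let F_i ⊆ F be a valid fault set for π'. Then for every subset A ⊆ F_i, the set F'_i = (F_i ∖ A) ∪ ⋃_{e ∈ A} B(e) is also a valid fault set for π'; that is, π' is a shortest path between its endpoints in G∖F'_i. -/
open SimpleGraph

/-- `e` is the first edge of the list `l` (of traversed edges) that belongs to `F`. -/
def FirstFault {V : Type} (F : Set (Sym2 V)) (l : List (Sym2 V)) (e : Sym2 V) : Prop :=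
  ∃ l₁ l₂, l = l₁ ++ e :: l₂ ∧ e ∈ F ∧ ∀ e' ∈ l₁, e' ∉ F

/-- The set `B(e)` of right base faults for a subpath with endpoints `x, y` and length
`len`: all `e*` such that some shortcut (a `x`–`y` walk in `G`, possibly non-simple, of
length `< len`) contains `e` and, traversed starting from `y`, has `e*` as its first
edge lying in `F`. -/
def BaseFaults {V : Type} (G : SimpleGraph V) (F : Set (Sym2 V)) (x y : V) (len : ℕ)
    (e : Sym2 V) : Set (Sym2 V) :=
  {e' | ∃ p : G.Walk x y, p.length < len ∧ e ∈ p.edges ∧ FirstFault F p.reverse.edges e'}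

/-- `F'` is a valid fault set for the path from `x` to `y` with vertex list `supp`:
that path is a shortest `x`–`y` path in `G \ F'`. -/
def ValidFor {V : Type} (G : SimpleGraph V) (F' : Set (Sym2 V)) (x y : V)
    (supp : List V) : Prop :=
  ∃ p : (G.deleteEdges F').Walk x y, p.support = supp ∧ p.IsPath ∧
    ∀ q : (G.deleteEdges F').Walk x y, q.IsPath → p.length ≤ q.length

theorem exists_firstFault {V : Type} (F : Set (Sym2 V)) (l : List (Sym2 V)) (e : Sym2 V)
    (he : e ∈ l) (heF : e ∈ F) : ∃ e', FirstFault F l e' := by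
  induction l with
  | nil => simp at he
  | cons a l ih =>
    by_cases ha : a ∈ F
    · exact ⟨a, [], l, rfl, ha, by simp⟩
    · have hel : e ∈ l := by
        rcases List.mem_cons.1 he with h | h
        · exact absurd (h ▸ heF) ha
        · exact h
      obtain ⟨e', l₁, l₂, h1, h2, h3⟩ := ih hel
      refine ⟨e', a :: l₁, l₂, by simp [h1], h2, ?_⟩
      intro b hb
      rcases List.mem_cons.1 hb with h | h
      · exact h ▸ ha
      · exact h3 b h

/-- Lemma on exchanging faults for base faults: let `P` be a shortest
`s`–`t` path in `G \ F`, let `P'` be a subpath of `P` with endpoints `x, y`, and let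
`F_i ⊆ F` be a valid fault set for `P'`. Then for every `A ⊆ F_i`, the set
`(F_i \ A) ∪ ⋃_{e ∈ A} B(e)` is also a valid fault set for `P'`. -/
theorem stmt_11 {V : Type} [Fintype V] (G : SimpleGraph V)
    (F : Set (Sym2 V)) (hF : F ⊆ G.edgeSet)
    (s t : V) (P : (G.deleteEdges F).Walk s t) (hPpath : P.IsPath)
    (hPshort : ∀ Q : (G.deleteEdges F).Walk s t, Q.IsPath → P.length ≤ Q.length)
    (x y : V) (P' : (G.deleteEdges F).Walk x y) (hsub : P'.support <:+: P.support)
    (Fi : Set (Sym2 V)) (hFiF : Fi ⊆ F) (hvalid : ValidFor G Fi x y P'.support)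
    (A : Set (Sym2 V)) (hA : A ⊆ Fi) :
    ValidFor G ((Fi \ A) ∪ ⋃ e ∈ A, BaseFaults G F x y P'.length e) x y P'.support := by
  obtain ⟨p, hps, hpp, hpmin⟩ := hvalid
  have hlen : p.length = P'.length := by
    have h := congrArg List.length hps
    simpa using h
  have hP'path : P'.IsPath := by
    rw [Walk.isPath_def, ← hps]
    exact hpp.support_nodup
  set F' := (Fi \ A) ∪ ⋃ e ∈ A, BaseFaults G F x y P'.length e with hF'
  have hsubF : F' ⊆ F := by
    rintro e (h | h)
    · exact hFiF h.1
    · simp only [Set.mem_iUnion] at h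
      obtain ⟨e₀, _, q, _, _, l₁, l₂, _, h2, _⟩ := h
      exact h2
  have hle : G.deleteEdges F ≤ G.deleteEdges F' := deleteEdges_anti hsubF
  refine ⟨P'.mapLe hle, by simp, by simpa using hP'path, ?_⟩
  intro q hq
  by_contra hlt
  have hqlen : q.length < P'.length := by simpa using hlt
  have hqF' : ∀ e ∈ q.edges, e ∈ G.edgeSet ∧ e ∉ F' := by
    intro e he
    have := q.edges_subset_edgeSet he
    rw [edgeSet_deleteEdges] at this
    exact this
  have hqA : ∀ e ∈ q.edges, e ∉ A := by
    intro e he heA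
    obtain ⟨e', he'⟩ := exists_firstFault F (q.mapLe (deleteEdges_le F')).reverse.edges e
      (by simpa using he) (hFiF (hA heA))
    have hmem : e' ∈ q.edges := by
      obtain ⟨l₁, l₂, h1, _, _⟩ := he'
      have h : e' ∈ (q.mapLe (deleteEdges_le F')).reverse.edges := by rw [h1]; simp
      simpa using h
    refine (hqF' e' hmem).2 (Or.inr ?_)
    simp only [Set.mem_iUnion]
    exact ⟨e, heA, q.mapLe (deleteEdges_le F'), by simpa using hqlen, by simpa using he, he'⟩
  have hqFi : ∀ e ∈ q.edges, e ∈ (G.deleteEdges Fi).edgeSet := by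
    intro e he
    rw [edgeSet_deleteEdges]
    exact ⟨(hqF' e he).1, fun h => (hqF' e he).2 (Or.inl ⟨h, hqA e he⟩)⟩
  have h := hpmin (q.transfer _ hqFi) (hq.transfer hqFi)
  rw [Walk.length_transfer] at h
  omega
end

section
/- Let π' be a subpath of π, and let F_i ⊆ F be a valid fault set for π' of minimum cardinality among all valid fault sets for π' contained in F. Then there exists an injective map φ : F_i → F such that φ(e) ∈ B(e) for every e ∈ F_i. -/
open SimpleGraph

/-- existence of a system of distinct base faults: let `P` be a shortest
`s`–`t` path in `G \ F`, let `P'` be a subpath of `P` with endpoints `x, y`, and let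
`F_i ⊆ F` be a valid fault set for `P'` of minimum cardinality among all valid fault sets
for `P'` contained in `F`. Then there is an injective map `φ : F_i → F` with
`φ(e) ∈ B(e)` for all `e ∈ F_i`. -/
theorem stmt_12 {V : Type} [Fintype V] (G : SimpleGraph V)
    (F : Set (Sym2 V)) (hF : F ⊆ G.edgeSet)
    (s t : V) (P : (G.deleteEdges F).Walk s t) (hPpath : P.IsPath)
    (hPshort : ∀ Q : (G.deleteEdges F).Walk s t, Q.IsPath → P.length ≤ Q.length)
    (x y : V) (P' : (G.deleteEdges F).Walk x y) (hsub : P'.support <:+: P.support)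
    (Fi : Set (Sym2 V)) (hFiF : Fi ⊆ F) (hvalid : ValidFor G Fi x y P'.support)
    (hmin : ∀ F'' : Set (Sym2 V), F'' ⊆ F → ValidFor G F'' x y P'.support →
      Fi.ncard ≤ F''.ncard) :
    ∃ φ : Sym2 V → Sym2 V, Set.InjOn φ Fi ∧
      ∀ e ∈ Fi, φ e ∈ F ∧ φ e ∈ BaseFaults G F x y P'.length e := by
  classical
  have hlenP : ∀ (F' : Set (Sym2 V)) (p : (G.deleteEdges F').Walk x y),
      p.support = P'.support → p.length = P'.length := by
    intro F' p h
    have := congrArg List.length h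
    simpa [Walk.length_support] using this
  have hP'path : P'.IsPath := by
    rw [Walk.isPath_def]
    exact (hsub.sublist).nodup ((Walk.isPath_def _).1 hPpath)
  let B : Sym2 V → Finset (Sym2 V) := fun e =>
    (Set.toFinite (BaseFaults G F x y P'.length e)).toFinset
  have hB : ∀ e e', e' ∈ B e ↔ e' ∈ BaseFaults G F x y P'.length e := by
    intro e e'; simp [B]
  have hBF : ∀ e e', e' ∈ B e → e' ∈ F := by
    intro e e' h
    obtain ⟨p, -, -, l₁, l₂, -, h, -⟩ := (hB e e').1 h
    exact h
  have first : ∀ l : List (Sym2 V), (∃ e ∈ l, e ∈ F) → ∃ e', FirstFault F l e' := by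
    intro l
    induction l with
    | nil => simp
    | cons a l ih =>
      intro h
      by_cases ha : a ∈ F
      · exact ⟨a, [], l, rfl, ha, by simp⟩
      · obtain ⟨e, he, heF⟩ := h
        have : e ∈ l := by
          rcases List.mem_cons.1 he with rfl | h
          · exact absurd heF ha
          · exact h
        obtain ⟨e', l₁, l₂, h1, h2, h3⟩ := ih ⟨e, this, heF⟩
        refine ⟨e', a :: l₁, l₂, by simp [h1], h2, ?_⟩
        intro z hz
        rcases List.mem_cons.1 hz with rfl | h
        · exact ha
        · exact h3 z h
  have hall : ∀ S : Finset Fi, S.card ≤ (S.biUnion (fun e => B e.1)).card := by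
    intro S
    by_contra! hlt
    let T : Finset (Sym2 V) := S.map (Function.Embedding.subtype _)
    have hTmem : ∀ e, e ∈ T ↔ ∃ h : e ∈ Fi, (⟨e, h⟩ : Fi) ∈ S := by
      intro e; simp [T]
    have hTFi : (T : Set (Sym2 V)) ⊆ Fi := fun e he => ((hTmem e).1 he).1
    let U := S.biUnion (fun e => B e.1)
    have hUmem : ∀ e', e' ∈ U ↔ ∃ e ∈ T, e' ∈ B e := by
      intro e'; simp [U, T]
    have hsubF : (Fi \ T) ∪ (U : Set (Sym2 V)) ⊆ F := by
      rintro e (he | he)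
      · exact hFiF he.1
      · obtain ⟨e0, -, h⟩ := (hUmem e).1 he
        exact hBF _ _ h
    have hv : ValidFor G ((Fi \ T) ∪ (U : Set (Sym2 V))) x y P'.support := by
      have hle : G.deleteEdges F ≤ G.deleteEdges ((Fi \ T) ∪ (U : Set (Sym2 V))) :=
        deleteEdges_anti hsubF
      refine ⟨P'.mapLe hle, by simp, by simpa using hP'path, ?_⟩
      intro q hq
      by_contra! hql
      have hql' : q.length < P'.length := by simpa using hql
      have hqe : ∀ e ∈ q.edges, e ∈ G.edgeSet ∧ e ∉ (Fi \ T) ∪ (U : Set (Sym2 V)) := by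
        intro e he
        have := q.edges_subset_edgeSet he
        rw [edgeSet_deleteEdges] at this
        exact this
      have hex : ∃ e ∈ q.edges, e ∈ Fi := by
        by_contra! hno
        obtain ⟨p, hp1, hp2, hp3⟩ := hvalid
        have hq' : ∀ e ∈ q.edges, e ∈ (G.deleteEdges Fi).edgeSet := by
          intro e he
          rw [edgeSet_deleteEdges]
          exact ⟨(hqe e he).1, hno e he⟩
        have := hp3 (q.transfer _ hq') (hq.transfer hq')
        rw [Walk.length_transfer, hlenP _ p hp1] at this
        omega
      obtain ⟨e, heq, heFi⟩ := hex
      have heT : e ∈ T := by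
        by_contra h
        exact (hqe e heq).2 (Or.inl ⟨heFi, h⟩)
      have hqG : ∀ e ∈ q.edges, e ∈ G.edgeSet := fun e he => (hqe e he).1
      let r := q.transfer G hqG
      have hre : r.edges = q.edges := Walk.edges_transfer q hqG
      have hrl : r.length = q.length := Walk.length_transfer q hqG
      obtain ⟨e', hff⟩ := first r.reverse.edges ⟨e, by simp [hre, heq], hFiF heFi⟩
      have hbe : e' ∈ B e := (hB _ _).2 ⟨r, by omega, by rw [hre]; exact heq, hff⟩
      have he'q : e' ∈ q.edges := by
        obtain ⟨l₁, l₂, h, -⟩ := hff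
        have : e' ∈ r.reverse.edges := by rw [h]; simp
        simpa [hre] using this
      exact (hqe e' he'q).2 (Or.inr ((hUmem e').2 ⟨e, heT, hbe⟩))
    have h1 := hmin _ hsubF hv
    have h2 := Set.ncard_union_le (Fi \ T) (U : Set (Sym2 V))
    have h3 := Set.ncard_sdiff_add_ncard_of_subset hTFi (Set.toFinite Fi)
    rw [Set.ncard_coe_finset] at h2 h3
    have h4 : T.card = S.card := Finset.card_map _
    have h5 : U.card < S.card := hlt
    omega
  obtain ⟨f, hf, hfB⟩ := (Finset.all_card_le_biUnion_card_iff_exists_injective _).1 hall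
  refine ⟨fun e => if h : e ∈ Fi then f ⟨e, h⟩ else e, ?_, ?_⟩
  · intro a ha b hb hab
    simp only [ha, hb, dif_pos] at hab
    exact congrArg Subtype.val (hf hab)
  · intro e he
    simp only [he, dif_pos]
    exact ⟨hBF _ _ (hfB ⟨e, he⟩), (hB _ _).1 (hfB ⟨e, he⟩)⟩
end

section
/- Let π' be a subpath of π, and let F_i ⊆ F be a valid fault set for π' of minimum cardinality among all valid fault sets for π' contained in F. Then for every e ∈ F_i there exists a shortcut of π' in G that contains the edge e and contains no edge of F_i ∖ {e}. -/
open SimpleGraph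

/-- let `P` be a shortest `s`–`t` path in `G \ F`, let `P'` be a subpath
of `P` with endpoints `x, y`, and let `F_i ⊆ F` be a valid fault set for `P'` of minimum
cardinality among all valid fault sets for `P'` contained in `F`. Then for every
`e ∈ F_i` there is a shortcut of `P'` in `G` (an `x`–`y` walk, possibly non-simple,
strictly shorter than `P'`) containing the edge `e` and no edge of `F_i \ {e}`. -/
theorem stmt_13 {V : Type} [Fintype V] (G : SimpleGraph V)
    (F : Set (Sym2 V)) (hF : F ⊆ G.edgeSet)
    (s t : V) (P : (G.deleteEdges F).Walk s t) (hPpath : P.IsPath)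
    (hPshort : ∀ Q : (G.deleteEdges F).Walk s t, Q.IsPath → P.length ≤ Q.length)
    (x y : V) (P' : (G.deleteEdges F).Walk x y) (hsub : P'.support <:+: P.support)
    (Fi : Set (Sym2 V)) (hFiF : Fi ⊆ F) (hvalid : ValidFor G Fi x y P'.support)
    (hmin : ∀ F'' : Set (Sym2 V), F'' ⊆ F → ValidFor G F'' x y P'.support →
      Fi.ncard ≤ F''.ncard) :
    ∀ e ∈ Fi, ∃ p : G.Walk x y, p.length < P'.length ∧ e ∈ p.edges ∧
      ∀ e' ∈ Fi, e' ≠ e → e' ∉ p.edges := by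
  classical
  intro e he
  by_contra hno
  push Not at hno
  have hfin : Fi.Finite := Set.toFinite Fi
  have hlt : (Fi \ {e}).ncard < Fi.ncard := Set.ncard_diff_singleton_lt_of_mem he hfin
  refine absurd (hmin (Fi \ {e}) (fun a ha => hFiF ha.1) ?_) (not_le.mpr hlt)
  obtain ⟨p, hps, hpp, hpm⟩ := hvalid
  have hle : G.deleteEdges Fi ≤ G.deleteEdges (Fi \ {e}) :=
    SimpleGraph.deleteEdges_anti Set.diff_subset
  have hlen : p.length = P'.length := by
    have := congrArg List.length hps
    simpa using this
  refine ⟨p.mapLe hle, by simp [hps], by simpa using hpp, ?_⟩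
  intro q hq
  by_contra hc
  have hc : q.length < p.length := by simpa using hc
  have hqe : ∀ a ∈ q.edges, a ∈ G.edgeSet ∧ a ∉ Fi \ {e} := by
    intro a ha
    have := q.edges_subset_edgeSet ha
    rw [SimpleGraph.edgeSet_deleteEdges] at this
    exact this
  have havoid : ∀ e' ∈ Fi, e' ≠ e → e' ∉ q.edges := fun e' h1 h2 h3 =>
    (hqe e' h3).2 ⟨h1, h2⟩
  have hne : e ∉ q.edges := by
    intro hin
    obtain ⟨e', h1, h2, h3⟩ := hno (q.mapLe (SimpleGraph.deleteEdges_le _))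
      (by simpa [← hlen] using hc) (by simpa using hin)
    exact havoid e' h1 h2 (by simpa using h3)
  have hq' : ∀ a ∈ q.edges, a ∈ (G.deleteEdges Fi).edgeSet := by
    intro a ha
    rw [SimpleGraph.edgeSet_deleteEdges]
    refine ⟨(hqe a ha).1, fun h => ?_⟩
    by_cases hae : a = e
    · exact hne (hae ▸ ha)
    · exact havoid a h hae ha
  have := hpm (q.transfer _ hq') (hq.transfer hq')
  rw [SimpleGraph.Walk.length_transfer] at this
  omega
end

section
/- For every edge e* ∈ F, there are at most 4 indices i such that (e*, π'_i) is a right FS-pair; that is, each fault of F appears in at most 4 right FS-pairs. -/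
open SimpleGraph

lemma firstFault_walk {V : Type} (G : SimpleGraph V) (F : Set (Sym2 V)) (e : Sym2 V) {x y : V}
    (p : G.Walk x y) (h : FirstFault F p.edges e) :
    ∃ u ∈ e, ∃ w : (G.deleteEdges F).Walk x u, w.length + 1 ≤ p.length := by
  induction p with
  | nil =>
    obtain ⟨l₁, l₂, h, -⟩ := h
    simp at h
  | @cons a b c hab p ih =>
    obtain ⟨l₁, l₂, h, heF, hl⟩ := h
    rw [Walk.edges_cons] at h
    cases l₁ with
    | nil =>
      simp only [List.nil_append, List.cons.injEq] at h
      exact ⟨a, by rw [← h.1]; simp, Walk.nil, by simp⟩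
    | cons f l₁ =>
      simp only [List.cons_append, List.cons.injEq] at h
      obtain ⟨u, hu, w, hw⟩ := ih ⟨l₁, l₂, h.2, heF, fun e' he' => hl e' (by simp [he'])⟩
      have hf : s(a, b) ∉ F := by rw [h.1]; exact hl f (by simp)
      have hadj : (G.deleteEdges F).Adj a b := by
        rw [deleteEdges_adj]; exact ⟨hab, hf⟩
      exact ⟨u, hu, Walk.cons hadj w, by simp; omega⟩

lemma close_set (A : Set ℕ) (h : ∀ i ∈ A, ∀ j ∈ A, j ≤ i + 1) : ∃ m, A ⊆ {m, m + 1} := by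
  classical
  by_cases hA : ∃ n, n ∈ A
  · refine ⟨Nat.find hA, fun j hj => ?_⟩
    have h1 := h _ (Nat.find_spec hA) j hj
    have h2 := Nat.find_min' hA hj
    simp only [Set.mem_insert_iff, Set.mem_singleton_iff]
    omega
  · exact ⟨0, fun j hj => (hA ⟨j, hj⟩).elim⟩

lemma short_dist {V : Type} (H : SimpleGraph V) {s t : V} (P : H.Walk s t)
    (hP : ∀ Q : H.Walk s t, Q.IsPath → P.length ≤ Q.length) (a b : ℕ)
    (hb : b ≤ P.length) (w : H.Walk (P.getVert a) (P.getVert b)) : b ≤ a + w.length := by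
  classical
  let Q := ((P.take a).append w).append (P.drop b)
  have h1 := hP Q.bypass Q.bypass_isPath
  have h2 := Q.length_bypass_le_length
  have h3 : Q.length = (P.take a).length + w.length + (P.drop b).length := by
    simp [Q]
  rw [Walk.take_length, Walk.drop_length] at h3
  omega



/-- each fault is in at most 4 right FS-pairs: let `P` be a shortest
`s`–`t` path in `G \ F`, and fix boundary positions `ix 0 = 0 ≤ ix 1 ≤ ⋯ ≤ ix q = |P|`
along `P` with `ix (q-1) < |P|` (i.e. `x_{q-1} ≠ t`). The augmented subpath `π'_i`
(for `i ≤ q-2`) goes from position `ix i` to position `ix (i+1) + 1` and has length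
`ix (i+1) + 1 - ix i`; it is post-light if `i ≤ q - 3` and `|π'_i| ≤ |π'_{i+1}|`.
`(e*, π'_i)` is a right FS-pair if `π'_i` is post-light and some shortcut of `π'_i`
(a walk in `G` from `x'_{i+1}` to `x_i`, possibly non-simple, of length `< |π'_i|`) has
right base fault `e*` (its first edge lying in `F`). Then every `e* ∈ F` occurs in at
most 4 right FS-pairs. -/
theorem stmt_14 {V : Type} [Fintype V] (G : SimpleGraph V)
    (F : Set (Sym2 V)) (hF : F ⊆ G.edgeSet)
    (s t : V) (P : (G.deleteEdges F).Walk s t) (hPpath : P.IsPath)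
    (hPshort : ∀ Q : (G.deleteEdges F).Walk s t, Q.IsPath → P.length ≤ Q.length)
    (q : ℕ) (hq : 1 ≤ q) (ix : ℕ → ℕ)
    (hix0 : ix 0 = 0) (hixq : ix q = P.length)
    (hmono : ∀ i, i < q → ix i ≤ ix (i + 1))
    (hlast : ix (q - 1) < P.length) :
    ∀ e₀ ∈ F,
      {i : ℕ |
        (i + 3 ≤ q ∧ ix (i + 1) + 1 - ix i ≤ ix (i + 2) + 1 - ix (i + 1)) ∧
        ∃ p : G.Walk (P.support.getD (ix (i + 1) + 1) s) (P.support.getD (ix i) s),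
          p.length < ix (i + 1) + 1 - ix i ∧ FirstFault F p.edges e₀}.ncard ≤ 4 := by
  intro e₀ _
  have hmono' : ∀ k i, i + k ≤ q → ix i ≤ ix (i + k) := by
    intro k
    induction k with
    | zero => intro i _; exact le_rfl
    | succ k ih =>
      intro i hi
      exact (ih i (by omega)).trans (hmono (i + k) (by omega))
  have hm : ∀ i j, i ≤ j → j ≤ q → ix i ≤ ix j := by
    intro i j hij hj
    obtain ⟨k, rfl⟩ := Nat.exists_eq_add_of_le hij
    exact hmono' k i hj
  have hget : ∀ n, n ≤ P.length → P.support.getD n s = P.getVert n := by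
    intro n hn
    rw [P.getVert_eq_support_getElem hn]
    exact (List.getElem_eq_getD s).symm
  let A : V → Set ℕ := fun u => {i | i + 3 ≤ q ∧
    ix (i + 1) + 1 - ix i ≤ ix (i + 2) + 1 - ix (i + 1) ∧
    ∃ w : (G.deleteEdges F).Walk (P.getVert (ix (i + 1) + 1)) u,
      w.length + 2 ≤ ix (i + 1) + 1 - ix i}
  have hA : ∀ u, ∃ m, A u ⊆ {m, m + 1} := by
    intro u
    apply close_set
    rintro i ⟨hi, hli, w, hw⟩ j ⟨hj, hlj, w', hw'⟩
    by_contra hlt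
    have hjl : ix (j + 1) ≤ ix (q - 1) := hm _ _ (by omega) (by omega)
    have h := short_dist _ P hPshort _ _ (by omega) (w.append w'.reverse)
    rw [Walk.length_append, Walk.length_reverse] at h
    have h1 := hm (i + 2) j (by omega) (by omega)
    have h2 := hm (i + 1) (i + 2) (by omega) (by omega)
    have h3 := hm i (i + 1) (by omega) (by omega)
    have h4 := hm j (j + 1) (by omega) (by omega)
    omega
  induction e₀ using Sym2.ind with
  | _ u v =>
  obtain ⟨m, hmu⟩ := hA u
  obtain ⟨n, hnv⟩ := hA v
  have hsub : {i : ℕ |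
        (i + 3 ≤ q ∧ ix (i + 1) + 1 - ix i ≤ ix (i + 2) + 1 - ix (i + 1)) ∧
        ∃ p : G.Walk (P.support.getD (ix (i + 1) + 1) s) (P.support.getD (ix i) s),
          p.length < ix (i + 1) + 1 - ix i ∧ FirstFault F p.edges s(u, v)} ⊆
      (({m, m + 1, n, n + 1} : Finset ℕ) : Set ℕ) := by
    rintro i ⟨⟨hi, hl⟩, p, hp, hff⟩
    obtain ⟨z, hz, w, hw⟩ := firstFault_walk G F _ p hff
    have hjl : ix (i + 1) ≤ ix (q - 1) := hm _ _ (by omega) (by omega)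
    have hiz : i ∈ A z := by
      refine ⟨hi, hl, w.copy (hget _ (by omega)) rfl, ?_⟩
      rw [Walk.length_copy]
      omega
    rcases Sym2.mem_iff.1 hz with rfl | rfl
    · have := hmu hiz
      simp at this ⊢
      omega
    · have := hnv hiz
      simp at this ⊢
      omega
  refine (Set.ncard_le_ncard hsub (Finset.finite_toSet _)).trans ?_
  rw [Set.ncard_coe_finset]
  exact Finset.card_le_four
end

section
/- The total number of right FS-pairs is at most 4·|F|. -/
open SimpleGraph

theorem aux_prefix {V : Type} {G : SimpleGraph V} (F : Set (Sym2 V)) (e : Sym2 V)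
    (l₁ l₂ : List (Sym2 V)) : ∀ {a b : V} (p : G.Walk a b), p.edges = l₁ ++ e :: l₂ →
    (∀ e' ∈ l₁, e' ∉ F) →
    ∃ u ∈ e, ∃ w : (G.deleteEdges F).Walk a u, w.length + 1 ≤ p.length := by
  induction l₁ with
  | nil =>
    intro a b p hp _
    cases p with
    | nil => simp at hp
    | cons h p' =>
      simp at hp
      refine ⟨a, ?_, Walk.nil, ?_⟩
      · rw [← hp.1]; simp
      · simp
  | cons x l ih =>
    intro a b p hp hl
    cases p with
    | nil => simp at hp
    | cons h p' =>
      simp at hp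
      obtain ⟨u, hu, w, hw⟩ := ih p' hp.2 (fun e' he' => hl e' (by simp [he']))
      refine ⟨u, hu, Walk.cons ?_ w, ?_⟩
      · rw [deleteEdges_adj]
        exact ⟨h, by rw [hp.1]; exact hl x (by simp)⟩
      · simp; omega

theorem aux_short_s15 {V : Type} {H : SimpleGraph V} {s t : V} (P : H.Walk s t)
    (hP : ∀ Q : H.Walk s t, Q.IsPath → P.length ≤ Q.length) (a b : ℕ)
    (hb : b ≤ P.length) (w : H.Walk (P.getVert a) (P.getVert b)) : b ≤ a + w.length := by
  classical
  have h := hP _ (((P.take a).append (w.append (P.drop b))).bypass_isPath)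
  have h2 := ((P.take a).append (w.append (P.drop b))).length_bypass_le_length
  simp only [Walk.length_append, Walk.drop_length, Walk.take_length] at h2
  omega

theorem aux_getD {V : Type} {H : SimpleGraph V} {s t : V} (P : H.Walk s t) (n : ℕ)
    (hn : n ≤ P.length) (d : V) : P.support.getD n d = P.getVert n := by
  rw [Walk.getVert_eq_support_getElem P hn, List.getD_eq_getElem]

theorem aux_two (J : Set ℕ) (h : ∀ i ∈ J, ∀ k ∈ J, k < i + 2) :
    ∃ m, ∀ i ∈ J, i = m ∨ i = m + 1 := by
  classical
  by_cases hJ : ∃ m, m ∈ J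
  · refine ⟨Nat.find hJ, fun i hi => ?_⟩
    have := Nat.find_min' hJ hi
    have := h _ (Nat.find_spec hJ) i hi
    omega
  · exact ⟨0, fun i hi => (hJ ⟨i, hi⟩).elim⟩

/-- at most `4·|F|` right FS-pairs in total: let `P` be a shortest
`s`–`t` path in `G \ F`, and fix boundary positions `ix 0 = 0 ≤ ix 1 ≤ ⋯ ≤ ix q = |P|`
along `P` with `ix (q-1) < |P|` (i.e. `x_{q-1} ≠ t`). The augmented subpath `π'_i`
(for `i ≤ q-2`) goes from position `ix i` to position `ix (i+1) + 1` and has length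
`ix (i+1) + 1 - ix i`; it is post-light if `i ≤ q - 3` and `|π'_i| ≤ |π'_{i+1}|`.
`(e*, π'_i)` is a right FS-pair if `e* ∈ F`, `π'_i` is post-light, and some shortcut of
`π'_i` (a walk in `G` from `x'_{i+1}` to `x_i`, possibly non-simple, of length
`< |π'_i|`) has right base fault `e*` (its first edge lying in `F`). Then the total
number of right FS-pairs is at most `4 * |F|`. -/
theorem stmt_15 {V : Type} [Fintype V] (G : SimpleGraph V)
    (F : Set (Sym2 V)) (hF : F ⊆ G.edgeSet)
    (s t : V) (P : (G.deleteEdges F).Walk s t) (hPpath : P.IsPath)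
    (hPshort : ∀ Q : (G.deleteEdges F).Walk s t, Q.IsPath → P.length ≤ Q.length)
    (q : ℕ) (hq : 1 ≤ q) (ix : ℕ → ℕ)
    (hix0 : ix 0 = 0) (hixq : ix q = P.length)
    (hmono : ∀ i, i < q → ix i ≤ ix (i + 1))
    (hlast : ix (q - 1) < P.length) :
    {pr : Sym2 V × ℕ |
      pr.1 ∈ F ∧
      (pr.2 + 3 ≤ q ∧ ix (pr.2 + 1) + 1 - ix pr.2 ≤ ix (pr.2 + 2) + 1 - ix (pr.2 + 1)) ∧
      ∃ p : G.Walk (P.support.getD (ix (pr.2 + 1) + 1) s) (P.support.getD (ix pr.2) s),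
        p.length < ix (pr.2 + 1) + 1 - ix pr.2 ∧
        FirstFault F p.edges pr.1}.ncard ≤ 4 * F.ncard := by
  classical
  have hm : ∀ j, j ≤ q → ∀ i, i ≤ j → ix i ≤ ix j := by
    intro j
    induction j with
    | zero => intro _ i hi; simp_all
    | succ j ih =>
      intro hj i hi
      rcases Nat.lt_or_ge j i with h | h
      · rw [show i = j + 1 by omega]
      · exact (ih (by omega) i h).trans (hmono j (by omega))
  set S := {pr : Sym2 V × ℕ |
      pr.1 ∈ F ∧
      (pr.2 + 3 ≤ q ∧ ix (pr.2 + 1) + 1 - ix pr.2 ≤ ix (pr.2 + 2) + 1 - ix (pr.2 + 1)) ∧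
      ∃ p : G.Walk (P.support.getD (ix (pr.2 + 1) + 1) s) (P.support.getD (ix pr.2) s),
        p.length < ix (pr.2 + 1) + 1 - ix pr.2 ∧
        FirstFault F p.edges pr.1} with hS
  let J : V → Set ℕ := fun u => {i | i + 3 ≤ q ∧
    ix (i + 1) + 1 - ix i ≤ ix (i + 2) + 1 - ix (i + 1) ∧
    ∃ w : (G.deleteEdges F).Walk (P.getVert (ix (i + 1) + 1)) u,
      w.length + 2 ≤ ix (i + 1) + 1 - ix i}
  have hpos : ∀ i, i + 3 ≤ q → ix (i + 1) + 1 ≤ P.length := by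
    intro i hi
    have := hm (q - 1) (by omega) (i + 1) (by omega)
    omega
  have hJ : ∀ u, ∃ m, ∀ i ∈ J u, i = m ∨ i = m + 1 := by
    intro u
    apply aux_two
    rintro i ⟨hi, hi2, w, hw⟩ k ⟨hk, hk2, w', hw'⟩
    by_contra hlt
    have h1 := aux_short_s15 P hPshort _ _ (hpos k hk) (w.append w'.reverse)
    simp only [Walk.length_append, Walk.length_reverse] at h1
    have h2 := hm k (by omega) (i + 2) (by omega)
    have h3 := hm (i + 1) (by omega) i (by omega)
    have h4 := hm (i + 2) (by omega) (i + 1) (by omega)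
    have h5 := hm (k + 1) (by omega) k (by omega)
    omega
  have hSJ : ∀ pr ∈ S, ∃ u ∈ pr.1, pr.2 ∈ J u := by
    rintro ⟨e, i⟩ ⟨he, ⟨hi, hi2⟩, p, hp, l₁, l₂, hl, -, hl₁⟩
    obtain ⟨u, hu, w, hw⟩ := aux_prefix F e l₁ l₂ p hl hl₁
    refine ⟨u, hu, hi, hi2, w.copy (aux_getD P _ (hpos i hi) s) rfl, ?_⟩
    rw [Walk.length_copy]
    change _ ≤ ix (i + 1) + 1 - ix i
    change p.length < ix (i + 1) + 1 - ix i at hp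
    omega
  have hFfin : F.Finite := Set.toFinite F
  have hSfin : S.Finite := by
    apply (hFfin.prod (Set.finite_lt_nat q)).subset
    rintro ⟨e, i⟩ ⟨he, ⟨hi, -⟩, -⟩
    exact ⟨he, by simp only [Set.mem_ofPred_eq]; omega⟩
  rw [Set.ncard_eq_toFinset_card S hSfin, Set.ncard_eq_toFinset_card F hFfin]
  refine Finset.card_le_mul_card_image_of_maps_to (f := Prod.fst) ?_ 4 ?_
  · intro pr hpr
    simp only [Set.Finite.coe_toFinset, Set.Finite.mem_toFinset] at hpr ⊢
    exact hpr.1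
  · intro e _
    induction e using Sym2.ind with
    | _ u v =>
    obtain ⟨m, hm1⟩ := hJ u
    obtain ⟨n, hn1⟩ := hJ v
    refine le_trans (Finset.card_le_card (t := {(s(u, v), m), (s(u, v), m + 1),
      (s(u, v), n), (s(u, v), n + 1)}) ?_) Finset.card_le_four
    rintro ⟨e, i⟩ hei
    simp only [Finset.mem_filter, Set.Finite.mem_toFinset] at hei
    obtain ⟨hei, rfl⟩ := hei
    obtain ⟨x, hx, hxi⟩ := hSJ _ hei
    simp only [Sym2.mem_iff] at hx
    simp only [Finset.mem_insert, Finset.mem_singleton, Prod.mk.injEq, true_and]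
    rcases hx with rfl | rfl
    · have := hm1 i hxi; tauto
    · have := hn1 i hxi; tauto
end

section
/- For every edge e* ∈ F, there are at most 4 indices i such that (e*, π'_i) is a right FS-pair; that is, in the weighted setting each fault of F appears in at most 4 right FS-pairs. -/
open SimpleGraph

theorem walk_prefix_aux {V : Type} {G : SimpleGraph V} {a b : V} (p : G.Walk a b)
    (e : Sym2 V) (l₁ l₂ : List (Sym2 V)) (h : p.edges = l₁ ++ e :: l₂) :
    ∃ y, y ∈ e ∧ ∃ r : G.Walk a y, r.edges = l₁ := by
  induction p generalizing l₁ with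
  | nil => simp at h
  | @cons u v x hadj p ih =>
    cases l₁ with
    | nil =>
      simp at h
      exact ⟨u, by rw [← h.1]; simp, Walk.nil, by simp⟩
    | cons e' l =>
      simp at h
      obtain ⟨y, hy, r, hr⟩ := ih l h.2
      exact ⟨y, hy, Walk.cons hadj r, by simp [hr, h.1]⟩

theorem sublist_sum_aux {α : Type} (w : α → ℝ) {l₁ l₂ : List α} (h : l₁.Sublist l₂)
    (hn : ∀ e ∈ l₂, 0 ≤ w e) : (l₁.map w).sum ≤ (l₂.map w).sum := by
  induction h with
  | slnil => simp
  | cons a h ih =>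
    have h1 := ih (fun e he => hn e (by simp [he]))
    have h2 := hn a (by simp)
    simp only [List.map_cons, List.sum_cons]
    linarith
  | cons_cons a h ih =>
    have h1 := ih (fun e he => hn e (by simp [he]))
    simp only [List.map_cons, List.sum_cons]
    linarith

theorem seg_sum_aux {α : Type} (w : α → ℝ) (l : List α) {a b : ℕ} (h : a ≤ b) :
    (((l.drop a).take (b - a)).map w).sum = ((l.take b).map w).sum - ((l.take a).map w).sum := by
  obtain ⟨c, rfl⟩ := Nat.exists_eq_add_of_le h
  rw [List.take_add]
  simp

theorem ncard_aux (A : Set ℕ) (h : ∀ i ∈ A, ∀ k ∈ A, ¬ (i + 2 ≤ k)) :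
    A.Finite ∧ A.ncard ≤ 2 := by
  classical
  rcases A.eq_empty_or_nonempty with rfl | hne
  · simp
  · have hm := Nat.sInf_mem hne
    have hsub : A ⊆ {sInf A, sInf A + 1} := by
      intro k hk
      have h1 := Nat.sInf_le hk
      have h2 := h _ hm k hk
      simp only [Set.mem_insert_iff, Set.mem_singleton_iff]
      omega
    have hf : ({sInf A, sInf A + 1} : Set ℕ).Finite := by simp
    exact ⟨hf.subset hsub, (Set.ncard_le_ncard hsub hf).trans (by rw [Set.ncard_pair (by omega)])⟩

theorem min_seg_aux {V : Type} (H : SimpleGraph V) (w : Sym2 V → ℝ)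
    (hw : ∀ e ∈ H.edgeSet, 0 ≤ w e) (s t : V) (P : H.Walk s t)
    (hP : ∀ Q : H.Walk s t, Q.IsPath → (P.edges.map w).sum ≤ (Q.edges.map w).sum)
    (a b : ℕ) (R : H.Walk (P.getVert a) (P.getVert b)) :
    ((P.edges.take b).map w).sum - ((P.edges.take a).map w).sum ≤ (R.edges.map w).sum := by
  classical
  let Q := ((P.take a).append R).append (P.drop b)
  have h1 := hP Q.bypass Q.bypass_isPath
  have h2 := sublist_sum_aux w (Walk.edges_bypass_sublist_edges Q)
    (fun e he => hw e (Walk.edges_subset_edgeSet _ he))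
  have h3 : (Q.edges.map w).sum = ((P.edges.take a).map w).sum + (R.edges.map w).sum
      + ((P.edges.drop b).map w).sum := by
    simp [Q, Walk.edges_append, Walk.edges_take, Walk.edges_drop, add_assoc]
  have h4 : (P.edges.map w).sum = ((P.edges.take b).map w).sum + ((P.edges.drop b).map w).sum := by
    rw [← List.sum_append, ← List.map_append, List.take_append_drop]
  linarith

/-- weighted setting: each fault is in at most 4 right FS-pairs: let
`G` carry positive real edge weights `w`, and let `P` be a minimum-weight `s`–`t` path in
`G \ F`. Fix a decomposition `P = π_0 ∘ e_0 ∘ π_1 ∘ e_1 ∘ ⋯ ∘ e_{q-2} ∘ π_{q-1}` by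
boundary positions `ix 0 = 0 ≤ ⋯ ≤ ix q = |P|`, where for `i ≤ q-2` the augmented
subpath `π'_i = π_i ∘ e_i` goes from position `ix i` to position `ix (i+1)` (so
`ix i < ix (i+1)` since it ends with the single edge `e_i` of `P`). Its weight `w(π'_i)`
is the sum of `w` over the corresponding edges of `P`; `π'_i` is post-light if
`i ≤ q - 3` and `w(π'_i) ≤ w(π'_{i+1})`. `(e*, π'_i)` is a right FS-pair if `π'_i` is
post-light and some shortcut of `π'_i` (a walk in `G` from `x_{i+1}` to `x_i`, possibly
non-simple, of total weight `< w(π'_i)`) has right base fault `e*` (its first edge lying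
in `F`). Then every `e* ∈ F` occurs in at most 4 right FS-pairs. -/
theorem stmt_16 {V : Type} [Fintype V] (G : SimpleGraph V)
    (w : Sym2 V → ℝ) (hw : ∀ e ∈ G.edgeSet, 0 < w e)
    (F : Set (Sym2 V)) (hF : F ⊆ G.edgeSet)
    (s t : V) (P : (G.deleteEdges F).Walk s t) (hPpath : P.IsPath)
    (hPshort : ∀ Q : (G.deleteEdges F).Walk s t, Q.IsPath →
      (P.edges.map w).sum ≤ (Q.edges.map w).sum)
    (q : ℕ) (hq : 1 ≤ q) (ix : ℕ → ℕ)
    (hix0 : ix 0 = 0) (hixq : ix q = P.length)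
    (hmono : ∀ i, i < q → ix i ≤ ix (i + 1))
    (hstrict : ∀ i, i + 2 ≤ q → ix i < ix (i + 1)) :
    ∀ e₀ ∈ F,
      {i : ℕ |
        (i + 3 ≤ q ∧
          (((P.edges.drop (ix i)).take (ix (i + 1) - ix i)).map w).sum ≤
          (((P.edges.drop (ix (i + 1))).take (ix (i + 2) - ix (i + 1))).map w).sum) ∧
        ∃ p : G.Walk (P.support.getD (ix (i + 1)) s) (P.support.getD (ix i) s),
          (p.edges.map w).sum <
            (((P.edges.drop (ix i)).take (ix (i + 1) - ix i)).map w).sum ∧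
          FirstFault F p.edges e₀}.ncard ≤ 4 := by
  intro e₀ he₀
  have hwH : ∀ e ∈ (G.deleteEdges F).edgeSet, 0 ≤ w e := by
    intro e he
    rw [edgeSet_deleteEdges] at he
    exact (hw e he.1).le
  have hmono' : ∀ i j, i ≤ j → j ≤ q → ix i ≤ ix j := by
    intro i j hij
    induction j, hij using Nat.le_induction with
    | base => intro _; exact le_rfl
    | succ j _ ih => intro hj; exact (ih (by omega)).trans (hmono j (by omega))
  let S : ℕ → ℝ := fun i => ((P.edges.take (ix i)).map w).sum
  have hS : ∀ i j, i ≤ j → j ≤ q → S i ≤ S j := by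
    intro i j hij hj
    exact sublist_sum_aux w (List.take_sublist_take_left (hmono' i j hij hj))
      (fun e he => hwH e (Walk.edges_subset_edgeSet _ (List.mem_of_mem_take he)))
  let A : V → Set ℕ := fun y => {i : ℕ | i + 3 ≤ q ∧ S (i+1) - S i ≤ S (i+2) - S (i+1) ∧
    ∃ r : (G.deleteEdges F).Walk (P.getVert (ix (i+1))) y,
      (r.edges.map w).sum < S (i+1) - S i}
  have hA : ∀ y, (A y).Finite ∧ (A y).ncard ≤ 2 := by
    intro y
    apply ncard_aux
    rintro i ⟨hi, hil, r, hr⟩ k ⟨hk, -, r', hr'⟩ hik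
    have h1 := min_seg_aux _ w hwH s t P hPshort _ _ (r.append r'.reverse)
    have h2 : ((r.append r'.reverse).edges.map w).sum
        = (r.edges.map w).sum + (r'.edges.map w).sum := by
      simp [Walk.edges_append, List.sum_reverse]
    have h3 := hS (i+2) k hik (by omega)
    change S (k+1) - S (i+1) ≤ _ at h1
    linarith
  have key : ∀ x y : V, e₀ = s(x, y) → ∀ B : Set ℕ, (∀ i ∈ B, ∃ z ∈ e₀, i ∈ A z) →
      B.ncard ≤ 4 := by
    intro x y hxy B hB
    have hsub : B ⊆ A x ∪ A y := by
      intro i hi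
      obtain ⟨z, hz, hiz⟩ := hB i hi
      rw [hxy, Sym2.mem_iff] at hz
      rcases hz with rfl | rfl
      · exact Or.inl hiz
      · exact Or.inr hiz
    have h1 := Set.ncard_le_ncard hsub ((hA x).1.union (hA y).1)
    have h2 := Set.ncard_union_le (A x) (A y)
    have h3 := (hA x).2
    have h4 := (hA y).2
    omega
  obtain ⟨x, y, hxy⟩ : ∃ x y, e₀ = s(x, y) := by
    induction e₀ using Sym2.ind with
    | _ x y => exact ⟨x, y, rfl⟩
  apply key x y hxy
  rintro i ⟨⟨hi, hil⟩, p, hp, l₁, l₂, hl, -, hl₁⟩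
  rw [seg_sum_aux w _ (hmono' i (i+1) (by omega) (by omega))] at hil hp
  rw [seg_sum_aux w _ (hmono' (i+1) (i+2) (by omega) (by omega))] at hil
  obtain ⟨z, hz, r, hr⟩ := walk_prefix_aux p e₀ l₁ l₂ hl
  refine ⟨z, hz, hi, hil, ?_⟩
  have hlen : ix (i+1) ≤ P.length := hixq ▸ hmono' (i+1) q (by omega) le_rfl
  have hv : P.support.getD (ix (i+1)) s = P.getVert (ix (i+1)) := by
    rw [Walk.getVert_eq_support_getElem P hlen]
    simp [List.getD_eq_getElem?_getD, hlen]
  have hre : ∀ e ∈ r.edges, e ∈ (G.deleteEdges F).edgeSet := by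
    intro e he
    rw [edgeSet_deleteEdges]
    exact ⟨Walk.edges_subset_edgeSet _ he, hl₁ e (hr ▸ he)⟩
  refine ⟨(r.transfer _ hre).copy hv rfl, ?_⟩
  have h1 : (l₁.map w).sum ≤ (p.edges.map w).sum := by
    apply sublist_sum_aux w
    · rw [hl]; exact List.sublist_append_left _ _
    · intro e he
      exact (hw e (Walk.edges_subset_edgeSet _ he)).le
  rw [Walk.edges_copy, Walk.edges_transfer, hr]
  exact h1.trans_lt hp
end
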